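/- Let ℜ = (S,(𝒦,𝒢),(X,ℬ),(ℱ,𝒯)) be a Riesz system, Z a uniform commutative monoid, and ℓ : ℱ → Z a Riesz integral over ℜ. Let R denote the family of all subsets α of S such that for every B∈ℬ and V∈unif Z there exist κ∈𝒦 and γ∈𝒢 with κ⊆α⊆γ and γ∖κ V-small with respect to (τ_ℓ, B). Then: (i) 𝒦∪𝒢 ⊆ R; (ii) R is a field of subsets of S; (iii) ν_ℓ agrees with τ_ℓ on 𝒦; (iv) ν_ℓ is additive on R, i.e. ν_ℓ(ρ₁∪ρ₂)(x) = ν_ℓ(ρ₁)(x) + ν_ℓ(ρ₂)(x) for all disjoint ρ₁,ρ₂∈R and x∈X; and (v) for every α⊆S and x∈X the defining limit ν_ℓ(α)(x) exists, the convergence of (ξ_ℓ(γ)(x) : γ∈𝒢, α⊆γ) being uniform for x in each B∈ℬ. -/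

import Mathlib

open Filter Set Topology
open scoped Pointwise

universe u v w

/-- A member of `unif M`: a closed, translation-invariant, symmetric entourage of the
uniform commutative monoid `M`. -/
def IsUnifEnt (M : Type*) [AddCommMonoid M] [UniformSpace M] (W : Set (M × M)) : Prop :=
  W ∈ uniformity M ∧ IsClosed W ∧
    (∀ p ∈ W, ∀ t : M, (p.1 + t, p.2 + t) ∈ W) ∧ ∀ p ∈ W, (p.2, p.1) ∈ W

/-- `f` is supported by `α` (written `f ≺ α`): `f` vanishes off some `κ ∈ 𝒦` with `κ ⊆ α`. -/
def SupportedBy {S : Type u} {X : Type v} [Zero X]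
    (𝒦 : Set (Set S)) (f : S → X) (α : Set S) : Prop :=
  ∃ κ ∈ 𝒦, κ ⊆ α ∧ ∀ s ∉ κ, f s = 0

/-- `f` equals `x` over `α`: `f` is identically `x` on some `γ ∈ 𝒢` containing `α`. -/
def EqualsOver {S : Type u} {X : Type v}
    (𝒢 : Set (Set S)) (f : S → X) (x : X) (α : Set S) : Prop :=
  ∃ γ ∈ 𝒢, α ⊆ γ ∧ ∀ s ∈ γ, f s = x

/-- `ℱ_B`: members of `ℱ` with range contained in `B`. -/
def FB {S : Type u} {X : Type v} (ℱ : Set (S → X)) (B : Set X) : Set (S → X) :=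
  {f | f ∈ ℱ ∧ Set.range f ⊆ B}

/-- the `ℬ`-hull of `x`: intersection of all members of `ℬ` containing `x`. -/
def BHull {X : Type v} (ℬ : Set (Set X)) (x : X) : Set X :=
  ⋂₀ {B | B ∈ ℬ ∧ x ∈ B}

/-- the `ℬ`-hull of a subset `A` of `X`. -/
def BHullS {X : Type v} (ℬ : Set (Set X)) (A : Set X) : Set X :=
  ⋂₀ {B | B ∈ ℬ ∧ A ⊆ B}

/-- A field of subsets of `S`. -/
def IsSetField {S : Type u} (ℰ : Set (Set S)) : Prop :=
  Set.univ ∈ ℰ ∧ (∀ A ∈ ℰ, Aᶜ ∈ ℰ) ∧ ∀ A ∈ ℰ, ∀ B ∈ ℰ, A ∪ B ∈ ℰ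

/-- `ℰ`: the smallest field of subsets of `S` containing `𝒦 ∪ 𝒢`. -/
def genField {S : Type u} (𝒦 𝒢 : Set (Set S)) : Set (Set S) :=
  ⋂₀ {ℰ | 𝒦 ∪ 𝒢 ⊆ ℰ ∧ IsSetField ℰ}

/-- A Riesz system `(S,(𝒦,𝒢),(X,ℬ),(ℱ,𝒯))` (Assumptions 2.3 of the paper). -/
structure RieszSystem {S : Type u} {X : Type v} [AddCommMonoid X] [UniformSpace X]
    (𝒦 𝒢 : Set (Set S)) (ℬ : Set (Set X)) (ℱ : Set (S → X))
    (𝒯 : Filter ((S → X) × (S → X))) : Prop where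
  K_empty : ∅ ∈ 𝒦
  K_union : ∀ κ₁ ∈ 𝒦, ∀ κ₂ ∈ 𝒦, κ₁ ∪ κ₂ ∈ 𝒦
  G_empty : ∅ ∈ 𝒢
  G_union : ∀ γ₁ ∈ 𝒢, ∀ γ₂ ∈ 𝒢, γ₁ ∪ γ₂ ∈ 𝒢
  G_inter : ∀ γ₁ ∈ 𝒢, ∀ γ₂ ∈ 𝒢, γ₁ ∩ γ₂ ∈ 𝒢
  KG_diff : ∀ κ ∈ 𝒦, ∀ γ ∈ 𝒢, κ \ γ ∈ 𝒦 ∧ γ \ κ ∈ 𝒢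
  KG_interpose : ∀ κ ∈ 𝒦, ∀ γ ∈ 𝒢, κ ⊆ γ →
      ∃ γ' ∈ 𝒢, ∃ κ' ∈ 𝒦, κ ⊆ γ' ∧ γ' ⊆ κ' ∧ κ' ⊆ γ
  X_add : UniformContinuous fun p : X × X => p.1 + p.2
  B_nonempty : ℬ.Nonempty
  B_inter : ∀ 𝒞 ⊆ ℬ, 𝒞.Nonempty → ⋂₀ 𝒞 ∈ ℬ
  B_zero : ∀ B ∈ ℬ, (0 : X) ∈ B
  B_add : ∀ B ∈ ℬ, ∀ B' ∈ ℬ, ∃ C ∈ ℬ, B + B' ⊆ C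
  B_cover : ∀ x : X, ∃ B ∈ ℬ, x ∈ B
  F_zero : (0 : S → X) ∈ ℱ
  F_add : ∀ f ∈ ℱ, ∀ g ∈ ℱ, f + g ∈ ℱ
  T_refl : ∀ T ∈ 𝒯, ∀ f ∈ ℱ, (f, f) ∈ T
  T_symm : ∀ T ∈ 𝒯, ∃ V ∈ 𝒯, ∀ f g : S → X, (f, g) ∈ V → (g, f) ∈ T
  T_comp : ∀ T ∈ 𝒯, ∃ V ∈ 𝒯, ∀ f g h : S → X, (f, g) ∈ V → (g, h) ∈ V → (f, h) ∈ T
  T_add : ∀ T ∈ 𝒯, ∃ V ∈ 𝒯, ∀ f f' g g' : S → X,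
      (f, f') ∈ V → (g, g') ∈ V → (f + g, f' + g') ∈ T
  F_range : ∀ f ∈ ℱ, ∃ B ∈ ℬ, Set.range f ⊆ B
  F_partble : ∀ f ∈ ℱ, ∀ W ∈ uniformity X, ∃ G : Finset (Set S), ↑G ⊆ 𝒢 ∧
      (⋃ γ ∈ G, γ) = Set.univ ∧ ∀ γ ∈ G, ∀ s ∈ γ, ∀ t ∈ γ, (f s, f t) ∈ W
  F_urysohn : ∀ κ ∈ 𝒦, ∀ γ ∈ 𝒢, κ ⊆ γ → ∀ x : X, ∃ f ∈ ℱ,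
      Set.range f ⊆ BHull ℬ x ∧ SupportedBy 𝒦 f γ ∧ EqualsOver 𝒢 f x κ
  F_ext : ∀ B ∈ ℬ, ∀ T ∈ 𝒯, ∃ U ∈ uniformity X, ∀ κ ∈ 𝒦, ∀ γ ∈ 𝒢, κ ⊆ γ →
      ∀ f ∈ FB ℱ B, ∀ g ∈ FB ℱ B, SupportedBy 𝒦 f γ → SupportedBy 𝒦 g γ →
      (∃ ω ∈ 𝒢, κ ⊆ ω ∧ ω ⊆ γ ∧ ∀ s ∈ ω, (f s, g s) ∈ U) →
      ∃ p ∈ FB ℱ B, ∃ q ∈ FB ℱ B, SupportedBy 𝒦 p (γ \ κ) ∧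
        SupportedBy 𝒦 q (γ \ κ) ∧ (f + p, g + q) ∈ T
  F_partunity : ∀ B ∈ ℬ, ∀ G : Finset (Set S), ↑G ⊆ 𝒢 → ∀ κ ∈ 𝒦, κ ⊆ (⋃ γ ∈ G, γ) →
      ∀ f ∈ FB ℱ B, ∃ g : Set S → (S → X),
        (∀ γ ∈ G, g γ ∈ FB ℱ B ∧ SupportedBy 𝒦 (g γ) γ) ∧
        (∀ J : Finset (Set S), J ⊆ G → (∑ γ ∈ J, g γ) ∈ FB ℱ B) ∧
        ∀ s ∈ κ, f s = ∑ γ ∈ G, g γ s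

/-- `f` and `g` are `ℰ`-separated. -/
def ESeparated {S : Type u} {X : Type v} [Zero X]
    (𝒦 𝒢 : Set (Set S)) (f g : S → X) : Prop :=
  ∃ E₁ ∈ genField 𝒦 𝒢, ∃ E₂ ∈ genField 𝒦 𝒢, Disjoint E₁ E₂ ∧
    SupportedBy 𝒦 f E₁ ∧ SupportedBy 𝒦 g E₂

/-- `ℓ` is `ℰ`-additive. -/
def EAdditive {S : Type u} {X : Type v} {Z : Type w} [AddCommMonoid X] [AddCommMonoid Z]
    (𝒦 𝒢 : Set (Set S)) (ℱ : Set (S → X)) (ℓ : (S → X) → Z) : Prop :=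
  ∀ f ∈ ℱ, ∀ g ∈ ℱ, ESeparated 𝒦 𝒢 f g → ℓ (f + g) = ℓ f + ℓ g

/-- `ℓ` is `s`-bounded over `ℬ`. -/
def SBounded {S : Type u} {X : Type v} {Z : Type w} [AddCommMonoid X]
    [AddCommMonoid Z] [UniformSpace Z]
    (𝒦 𝒢 : Set (Set S)) (ℬ : Set (Set X)) (ℱ : Set (S → X)) (ℓ : (S → X) → Z) : Prop :=
  ∀ B ∈ ℬ, ∀ W : Set (Z × Z), IsUnifEnt Z W → ∀ G : ℕ → Set S, (∀ n, G n ∈ 𝒢) →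
    (∀ m n : ℕ, m ≠ n → Disjoint (G m) (G n)) → ∃ m : ℕ, ∀ n > m,
      ∀ f ∈ FB ℱ B, ∀ g ∈ FB ℱ B, SupportedBy 𝒦 g (G n) → (ℓ f, ℓ (f + g)) ∈ W

/-- `ℓ` is uniformly continuous on `A` with respect to the uniformity `𝒯`. -/
def UContOn {S : Type u} {X : Type v} {Z : Type w} [UniformSpace Z]
    (𝒯 : Filter ((S → X) × (S → X))) (A : Set (S → X)) (ℓ : (S → X) → Z) : Prop :=
  ∀ W ∈ uniformity Z, ∃ T ∈ 𝒯, ∀ f ∈ A, ∀ g ∈ A, (f, g) ∈ T → (ℓ f, ℓ g) ∈ W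

/-- A relatively complete subset of a uniform space. -/
def RelComplete {Z : Type w} [UniformSpace Z] (A : Set Z) : Prop :=
  IsComplete (closure A)

/-- `ℓ` is a Riesz integral over the Riesz system `(S,(𝒦,𝒢),(X,ℬ),(ℱ,𝒯))`. -/
def RieszIntegral {S : Type u} {X : Type v} {Z : Type w} [AddCommMonoid X]
    [AddCommMonoid Z] [UniformSpace Z]
    (𝒦 𝒢 : Set (Set S)) (ℬ : Set (Set X)) (ℱ : Set (S → X))
    (𝒯 : Filter ((S → X) × (S → X))) (ℓ : (S → X) → Z) : Prop :=
  EAdditive 𝒦 𝒢 ℱ ℓ ∧ SBounded 𝒦 𝒢 ℬ ℱ ℓ ∧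
    ∀ B ∈ ℬ, UContOn 𝒯 (FB ℱ B) ℓ ∧ RelComplete (ℓ '' FB ℱ B)

/-- The members of a finite family of sets are pairwise disjoint. -/
def PairwiseDisjFinset {S : Type u} (K : Finset (Set S)) : Prop :=
  ∀ κ₁ ∈ K, ∀ κ₂ ∈ K, κ₁ ≠ κ₂ → Disjoint κ₁ κ₂

/-- `α` is `W`-small with respect to `(h, B)`. -/
def WSmall {S : Type u} {X : Type v} {Z : Type w} [AddCommMonoid X] [AddCommMonoid Z]
    (𝒦 𝒢 : Set (Set S)) (h : Set S → X → Z) (B : Set X)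
    (W : Set (Z × Z)) (α : Set S) : Prop :=
  ∃ γ ∈ 𝒢, α ⊆ γ ∧ ∀ K : Finset (Set S), ↑K ⊆ 𝒦 → PairwiseDisjFinset K →
    (∀ κ ∈ K, κ ⊆ γ) → ∀ x y : Set S → X, (∀ κ ∈ K, x κ ∈ B) → (∀ κ ∈ K, y κ ∈ B) →
      (∑ κ ∈ K, h κ (x κ), ∑ κ ∈ K, h κ (x κ + y κ)) ∈ W

/-- `α` is regular with respect to `(h, 𝒦, 𝒢, ℬ)`. -/
def RegularSet {S : Type u} {X : Type v} {Z : Type w} [AddCommMonoid X]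
    [AddCommMonoid Z] [UniformSpace Z]
    (𝒦 𝒢 : Set (Set S)) (ℬ : Set (Set X)) (h : Set S → X → Z) (α : Set S) : Prop :=
  ∀ B ∈ ℬ, ∀ V : Set (Z × Z), IsUnifEnt Z V →
    ∃ κ ∈ 𝒦, ∃ γ ∈ 𝒢, κ ⊆ α ∧ α ⊆ γ ∧ WSmall 𝒦 𝒢 h B V (γ \ κ)

/-- `R_h`: the family of regular sets of `h`. -/
def RSet {S : Type u} {X : Type v} {Z : Type w} [AddCommMonoid X]
    [AddCommMonoid Z] [UniformSpace Z]
    (𝒦 𝒢 : Set (Set S)) (ℬ : Set (Set X)) (h : Set S → X → Z) : Set (Set S) :=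
  {α | RegularSet 𝒦 𝒢 ℬ h α}

/-- `h` is uniformly partition continuous with respect to `(𝒦,𝒢,ℬ)`. -/
def UPartCont {S : Type u} {X : Type v} {Z : Type w} [AddCommMonoid X] [UniformSpace X]
    [AddCommMonoid Z] [UniformSpace Z]
    (𝒦 𝒢 : Set (Set S)) (ℬ : Set (Set X)) (h : Set S → X → Z) : Prop :=
  ∀ W : Set (Z × Z), IsUnifEnt Z W → ∀ B ∈ ℬ, ∃ U ∈ uniformity X,
    ∀ R : Finset (Set S), ↑R ⊆ RSet 𝒦 𝒢 ℬ h → PairwiseDisjFinset R →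
    ∀ x y : Set S → X, (∀ ρ ∈ R, x ρ ∈ B ∧ y ρ ∈ B ∧ (x ρ, y ρ) ∈ U) →
      (∑ ρ ∈ R, h ρ (x ρ), ∑ ρ ∈ R, h ρ (y ρ)) ∈ W

/-- `h` is `s`-bounded with respect to `(𝒦,𝒢,ℬ)`. -/
def MSBounded {S : Type u} {X : Type v} {Z : Type w} [AddCommMonoid X]
    [AddCommMonoid Z] [UniformSpace Z]
    (𝒦 𝒢 : Set (Set S)) (ℬ : Set (Set X)) (h : Set S → X → Z) : Prop :=
  ∀ B ∈ ℬ, ∀ α : ℕ → Set S, (∀ n, α n ∈ RSet 𝒦 𝒢 ℬ h) →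
    (∀ m n : ℕ, m ≠ n → Disjoint (α m) (α n)) → ∀ V : Set (Z × Z), IsUnifEnt Z V →
      ∃ m : ℕ, ∀ n > m, WSmall 𝒦 𝒢 h B V (α n)

/-- `𝒱(h,𝒦,𝒢,B)`: all finite sums `∑_{ρ∈R} x_ρ.h(ρ)`. -/
def VSums {S : Type u} {X : Type v} {Z : Type w} [AddCommMonoid X]
    [AddCommMonoid Z] [UniformSpace Z]
    (𝒦 𝒢 : Set (Set S)) (ℬ : Set (Set X)) (h : Set S → X → Z) (B : Set X) : Set Z :=
  {z | ∃ R : Finset (Set S), ↑R ⊆ RSet 𝒦 𝒢 ℬ h ∧ PairwiseDisjFinset R ∧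
    ∃ x : Set S → X, (∀ ρ ∈ R, x ρ ∈ B) ∧ z = ∑ ρ ∈ R, h ρ (x ρ)}

/-- `z` is the limit of the net `(F κ x : κ ∈ 𝒦, κ ⊆ γ)` directed by inclusion. -/
def KBelowLim {S : Type u} {X : Type v} {Z : Type w} [TopologicalSpace Z]
    (𝒦 : Set (Set S)) (γ : Set S) (F : Set S → X → Z) (x : X) (z : Z) : Prop :=
  Tendsto (fun κ : {κ : Set S // κ ∈ 𝒦 ∧ κ ⊆ γ} => F κ.1 x) atTop (nhds z)

/-- `z` is the limit of the net `(F γ' x : γ' ∈ 𝒢, α ⊆ γ')` directed by reverse inclusion. -/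
def GAboveLim {S : Type u} {X : Type v} {Z : Type w} [TopologicalSpace Z]
    (𝒢 : Set (Set S)) (α : Set S) (F : Set S → X → Z) (x : X) (z : Z) : Prop :=
  Tendsto (fun γ : {γ : Set S // γ ∈ 𝒢 ∧ α ⊆ γ} => F γ.1 x) atBot (nhds z)

/-- `h` is a Riesz measure over `(𝒦,𝒢,ℬ)`. -/
def RieszMeasure {S : Type u} {X : Type v} {Z : Type w} [AddCommMonoid X] [UniformSpace X]
    [AddCommMonoid Z] [UniformSpace Z]
    (𝒦 𝒢 : Set (Set S)) (ℬ : Set (Set X)) (h : Set S → X → Z) : Prop :=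
  𝒢 ⊆ RSet 𝒦 𝒢 ℬ h ∧
  IsSetField (RSet 𝒦 𝒢 ℬ h) ∧
  (∀ ρ₁ ∈ RSet 𝒦 𝒢 ℬ h, ∀ ρ₂ ∈ RSet 𝒦 𝒢 ℬ h, Disjoint ρ₁ ρ₂ →
      ∀ x : X, h (ρ₁ ∪ ρ₂) x = h ρ₁ x + h ρ₂ x) ∧
  (∀ γ ∈ 𝒢, ∀ x : X, KBelowLim 𝒦 γ h x (h γ x)) ∧
  (∀ α : Set S, ∀ x : X, GAboveLim 𝒢 α h x (h α x)) ∧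
  UPartCont 𝒦 𝒢 ℬ h ∧ MSBounded 𝒦 𝒢 ℬ h ∧
  ∀ B ∈ ℬ, RelComplete (VSums 𝒦 𝒢 ℬ h B)

/-- The finite disjoint family `R` refines `Q`. -/
def RefinesF {S : Type u} (R Q : Finset (Set S)) : Prop :=
  ∀ ρ ∈ R, ∃ q ∈ Q, ρ ⊆ q

/-- `R` is a finite disjoint partition of `E` by sets regular for `h`. -/
def IsPartitionOf {S : Type u} {X : Type v} {Z : Type w} [AddCommMonoid X]
    [AddCommMonoid Z] [UniformSpace Z]
    (𝒦 𝒢 : Set (Set S)) (ℬ : Set (Set X)) (h : Set S → X → Z)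
    (R : Finset (Set S)) (E : Set S) : Prop :=
  ↑R ⊆ RSet 𝒦 𝒢 ℬ h ∧ PairwiseDisjFinset R ∧ (⋃ ρ ∈ R, ρ) = E

/-- `z = ∫_E f.dμ`. -/
def IsIntegralOf {S : Type u} {X : Type v} {Z : Type w} [AddCommMonoid X]
    [AddCommMonoid Z] [UniformSpace Z]
    (𝒦 𝒢 : Set (Set S)) (ℬ : Set (Set X)) (μ : Set S → X → Z)
    (E : Set S) (f : S → X) (z : Z) : Prop :=
  ∀ V ∈ nhds z, ∃ Q : Finset (Set S), IsPartitionOf 𝒦 𝒢 ℬ μ Q E ∧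
    ∀ R : Finset (Set S), IsPartitionOf 𝒦 𝒢 ℬ μ R E → RefinesF R Q →
      ∀ s : Set S → S, (∀ ρ ∈ R, s ρ ∈ ρ) → (∑ ρ ∈ R, μ ρ (f (s ρ))) ∈ V

/-- `ℱ*(x,κ,γ,B)`. -/
def FStar {S : Type u} {X : Type v} [Zero X]
    (𝒦 𝒢 : Set (Set S)) (ℱ : Set (S → X)) (x : X) (κ γ : Set S) (B : Set X) :
    Set (S → X) :=
  {f | f ∈ FB ℱ B ∧ EqualsOver 𝒢 f x κ ∧ SupportedBy 𝒦 f γ}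

/-- `τ` is the set function `τ_ℓ` generated by `ℓ` on `𝒦`. -/
def IsTau {S : Type u} {X : Type v} {Z : Type w} [AddCommMonoid X] [UniformSpace Z]
    (𝒦 𝒢 : Set (Set S)) (ℬ : Set (Set X)) (ℱ : Set (S → X))
    (ℓ : (S → X) → Z) (τ : Set S → X → Z) : Prop :=
  ∀ κ ∈ 𝒦, ∀ x : X, ∀ V ∈ nhds (τ κ x), ∃ β ∈ 𝒢, κ ⊆ β ∧
    ℓ '' FStar 𝒦 𝒢 ℱ x κ β (BHull ℬ x) ⊆ V

/-- `ξ = ξ_ℓ` is the pointwise limit of `τ = τ_ℓ` over `𝒦⁻(γ)`. -/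
def IsXi {S : Type u} {X : Type v} {Z : Type w} [TopologicalSpace Z]
    (𝒦 𝒢 : Set (Set S)) (τ ξ : Set S → X → Z) : Prop :=
  ∀ γ ∈ 𝒢, ∀ x : X, KBelowLim 𝒦 γ τ x (ξ γ x)

/-- `ν = ν_ℓ` is the pointwise limit of `ξ = ξ_ℓ` over `𝒢⁺(α)`. -/
def IsNu {S : Type u} {X : Type v} {Z : Type w} [TopologicalSpace Z]
    (𝒢 : Set (Set S)) (ξ ν : Set S → X → Z) : Prop :=
  ∀ α : Set S, ∀ x : X, GAboveLim 𝒢 α ξ x (ν α x)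

/-- `S(W,B,ℓ)`. -/
def SWB {S : Type u} {X : Type v} {Z : Type w} [AddCommMonoid X]
    (𝒦 𝒢 : Set (Set S)) (ℱ : Set (S → X)) (ℓ : (S → X) → Z)
    (W : Set (Z × Z)) (B : Set X) : Set (Set S) :=
  {γ | γ ∈ 𝒢 ∧ ∀ f ∈ FB ℱ B, ∀ g ∈ FB ℱ B, SupportedBy 𝒦 g γ → (ℓ f, ℓ (f + g)) ∈ W}

/-- `ℓ` has the Hammerstein property relative to `ℰ`. -/
def Hammerstein {S : Type u} {X : Type v} {Z : Type w} [AddCommMonoid X] [AddCommMonoid Z]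
    (𝒦 𝒢 : Set (Set S)) (ℱ : Set (S → X)) (ℓ : (S → X) → Z) : Prop :=
  ∀ f ∈ ℱ, ∀ g₁ ∈ ℱ, ∀ g₂ ∈ ℱ, ESeparated 𝒦 𝒢 g₁ g₂ →
    ℓ (f + g₁ + g₂) + ℓ f = ℓ (f + g₁) + ℓ (f + g₂)

/-- `ℓ` is quasi-additive. -/
def QuasiAdditive {S : Type u} {X : Type v} {Z : Type w} [AddCommMonoid X]
    [AddCommMonoid Z] [UniformSpace Z]
    (ℬ : Set (Set X)) (ℱ : Set (S → X)) (ℓ : (S → X) → Z) : Prop :=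
  ∀ W : Set (Z × Z), IsUnifEnt Z W → ∀ B ∈ ℬ, ∃ V : Set (Z × Z), IsUnifEnt Z V ∧
    ∀ f ∈ FB ℱ B, ∀ g ∈ FB ℱ B, ((0 : Z), ℓ g) ∈ V → (ℓ f, ℓ (f + g)) ∈ W

/-- A perfect subset of `Z`: any function whose finite partial sums all lie in the set
is summable. -/
def PerfectSet {Z : Type w} [AddCommMonoid Z] [TopologicalSpace Z] (A : Set Z) : Prop :=
  ∀ ⦃ι : Type w⦄ (g : ι → Z), (∀ J : Finset ι, ∑ i ∈ J, g i ∈ A) → Summable g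

/-- A quasi-perfect subset of `Z`: any function whose finite partial sums all lie in the
set has a Cauchy net of finite partial sums. -/
def QuasiPerfectSet {Z : Type w} [AddCommMonoid Z] [UniformSpace Z] (A : Set Z) : Prop :=
  ∀ ⦃ι : Type w⦄ (g : ι → Z), (∀ J : Finset ι, ∑ i ∈ J, g i ∈ A) →
    Cauchy (Filter.map (fun J : Finset ι => ∑ i ∈ J, g i) Filter.atTop)

/-- `α` is `U`-small with respect to `(ℓ, B)`. -/
def USmallOp {S : Type u}{X : Type v} {Z : Type w} [AddCommMonoid X] [Zero X]
    (𝒦 : Set (Set S)) (ℱ : Set (S → X)) (ℓ : (S → X) → Z) (B : Set X)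
    (U : Set (Z × Z)) (α : Set S) : Prop :=
  ∀ f ∈ FB ℱ B, ∀ g ∈ FB ℱ B, SupportedBy 𝒦 g α → (ℓ f, ℓ (f + g)) ∈ U

/-- `ℓ` is `𝒢`-bounded. -/
def GBounded {S : Type u} {X : Type v} {Z : Type w} [AddCommMonoid X]
    [AddCommMonoid Z] [UniformSpace Z]
    (𝒦 𝒢 : Set (Set S)) (ℬ : Set (Set X)) (ℱ : Set (S → X)) (ℓ : (S → X) → Z) : Prop :=
  ∀ U : Set (Z × Z), IsUnifEnt Z U → ∀ B ∈ ℬ, ∀ K ∈ 𝒦, ∀ 𝒢' ⊆ 𝒢, K ⊆ ⋃₀ 𝒢' →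
    ∃ H : Finset (Set S), ↑H ⊆ 𝒢' ∧ USmallOp 𝒦 ℱ ℓ B U (K \ ⋃ γ ∈ H, γ)

/-- `ℬ₀` (Notation 2.2). -/
def B0 {X : Type v} [AddCommMonoid X] (ℬ : Set (Set X)) : Set (Set X) :=
  ⋂₀ {ℋ | ℋ ⊆ ℬ ∧ (∀ 𝒞 ⊆ ℋ, 𝒞.Nonempty → ⋂₀ 𝒞 ∈ ℋ) ∧ ⋂₀ ℋ = {0} ∧
      (∀ x : X, BHull ℬ x ∈ ℋ) ∧ ∀ H₁ ∈ ℋ, ∀ H₂ ∈ ℋ, BHullS ℬ (H₁ + H₂) ∈ ℋ}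

/-- `ℱ₀` (Notation 2.2). -/
def F0 {S : Type u} {X : Type v} [AddCommMonoid X]
    (ℬ : Set (Set X)) (ℱ : Set (S → X)) : Set (S → X) :=
  {f | f ∈ ℱ ∧ ∃ B ∈ B0 ℬ, Set.range f ⊆ B}

/-- The uniformity of uniform convergence on `S`, as a filter on `(S → X) × (S → X)`. -/
def UnifConvFilter (S : Type u) (X : Type v) [UniformSpace X] :
    Filter ((S → X) × (S → X)) :=
  ⨅ V ∈ uniformity X, Filter.principal {p : (S → X) × (S → X) | ∀ s : S, (p.1 s, p.2 s) ∈ V}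

/-- The additional conditions of Remark 2.5.1 on a Riesz system. -/
structure Remark251 {S : Type u} {X : Type v} [TopologicalSpace S]
    [AddCommGroup X] [Module ℝ X] [UniformSpace X]
    (𝒦 𝒢 : Set (Set S)) (ℬ : Set (Set X)) (ℱ : Set (S → X))
    (𝒯 : Filter ((S → X) × (S → X))) : Prop where
  K_closed : ∀ κ ∈ 𝒦, IsClosed κ
  G_open : ∀ γ ∈ 𝒢, IsOpen γ
  B_def : ℬ = {B : Set X | IsClosed B ∧ TotallyBounded B}
  F_sub : ∀ f ∈ ℱ, Continuous f ∧ TotallyBounded (Set.range f)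
  F_module : ∀ φ : S → ℝ, Continuous φ → TotallyBounded (Set.range φ) →
      ∀ f ∈ ℱ, (fun s => φ s • f s) ∈ ℱ
  F_tensor : ∀ x : X, ∀ φ : S → ℝ, Continuous φ → TotallyBounded (Set.range φ) →
      (∃ κ ∈ 𝒦, ∀ s ∉ κ, φ s = 0) → (fun s => φ s • x) ∈ ℱ
  T_coarser : UnifConvFilter S X ≤ 𝒯

/-- `A` is a bounded subset of the "topological vector space" `(ℱ,𝒯)`:
it is absorbed by every `𝒯`-neighbourhood of `0`. -/
def FBddIn {S : Type u} {X : Type v} [AddCommGroup X] [Module ℝ X]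
    (𝒯 : Filter ((S → X) × (S → X))) (A : Set (S → X)) : Prop :=
  ∀ T ∈ 𝒯, ∃ r : ℝ, 0 < r ∧ ∀ f ∈ A, ∀ c : ℝ, |c| ≤ r → ((0 : S → X), c • f) ∈ T

section UniformMonoid

variable {Z : Type w} [AddCommMonoid Z] [UniformSpace Z]

theorem IsUnifEnt.rfl {V : Set (Z × Z)} (hV : IsUnifEnt Z V) (a : Z) : (a, a) ∈ V :=
  refl_mem_uniformity hV.1

theorem IsUnifEnt.symm {V : Set (Z × Z)} (hV : IsUnifEnt Z V) {a b : Z} (h : (a, b) ∈ V) :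
    (b, a) ∈ V :=
  hV.2.2.2 _ h

theorem IsUnifEnt.add_right {V : Set (Z × Z)} (hV : IsUnifEnt Z V) {a b : Z}
    (h : (a, b) ∈ V) (t : Z) : (a + t, b + t) ∈ V :=
  hV.2.2.1 _ h t

theorem IsUnifEnt.add_left {V : Set (Z × Z)} (hV : IsUnifEnt Z V) {a b : Z}
    (h : (a, b) ∈ V) (t : Z) : (t + a, t + b) ∈ V := by
  simpa only [add_comm t] using hV.add_right h t

/-- The closed, translation-invariant, symmetric entourages form a base. -/
theorem exists_isUnifEnt_subset (hZadd : UniformContinuous fun p : Z × Z => p.1 + p.2)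
    {W : Set (Z × Z)} (hW : W ∈ uniformity Z) : ∃ V, IsUnifEnt Z V ∧ V ⊆ W := by
  obtain ⟨W₁, ⟨hW₁, hc⟩, hW₁W⟩ := uniformity_hasBasis_closed.mem_iff.1 hW
  obtain ⟨N, hN, hNW⟩ : ∃ N ∈ uniformity Z,
      ∀ a b c d : Z, (a, b) ∈ N → (c, d) ∈ N → (a + c, b + d) ∈ W₁ := by
    have h := hZadd hW₁
    rw [Filter.mem_map, uniformity_prod_eq_comap_prod, Filter.mem_comap] at h
    obtain ⟨t, ht, hts⟩ := h
    obtain ⟨N₁, hN₁, N₂, hN₂, hN⟩ := Filter.mem_prod_iff.1 ht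
    refine ⟨N₁ ∩ N₂, Filter.inter_mem hN₁ hN₂, fun a b c d hab hcd => ?_⟩
    have : ((a, c), (b, d)) ∈ (fun x : (Z × Z) × Z × Z => (x.1.1 + x.1.2, x.2.1 + x.2.2)) ⁻¹' W₁ :=
      hts (hN (show ((a, b), (c, d)) ∈ N₁ ×ˢ N₂ from ⟨hab.1, hcd.2⟩))
    exact this
  have hcont (t : Z) : Continuous fun a : Z => a + t :=
    hZadd.continuous.comp (Continuous.prodMk_left t)
  let E : Set (Z × Z) := {p | ∀ t, (p.1 + t, p.2 + t) ∈ W₁}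
  have hE : E ∈ uniformity Z :=
    Filter.mem_of_superset hN fun p hp t => hNW _ _ _ _ hp (refl_mem_uniformity hN)
  have hEc : IsClosed E := by
    have : E = ⋂ t, (fun p : Z × Z => (p.1 + t, p.2 + t)) ⁻¹' W₁ := by
      ext p; simp [E]
    rw [this]
    exact isClosed_iInter fun t => hc.preimage
      (((hcont t).comp continuous_fst).prodMk ((hcont t).comp continuous_snd))
  have hEadd : ∀ p ∈ E, ∀ t, (p.1 + t, p.2 + t) ∈ E := fun p hp t s => by
    simpa only [add_assoc] using hp (t + s)
  refine ⟨E ∩ Prod.swap ⁻¹' E, ⟨Filter.inter_mem hE (tendsto_swap_uniformity hE),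
    hEc.inter (hEc.preimage continuous_swap),
    fun p hp t => ⟨hEadd p hp.1 t, hEadd _ hp.2 t⟩, fun p hp => ⟨hp.2, hp.1⟩⟩, ?_⟩
  rintro ⟨a, b⟩ ⟨h, -⟩
  simpa using hW₁W (h 0)

theorem exists_isUnifEnt_comp (hZadd : UniformContinuous fun p : Z × Z => p.1 + p.2)
    {W : Set (Z × Z)} (hW : W ∈ uniformity Z) :
    ∃ V, IsUnifEnt Z V ∧ V ⊆ W ∧
      ∀ a b c d e, (a, b) ∈ V → (b, c) ∈ V → (c, d) ∈ V → (d, e) ∈ V → (a, e) ∈ W := by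
  obtain ⟨W₁, hW₁, h₁⟩ := comp_mem_uniformity_sets hW
  obtain ⟨W₂, hW₂, h₂⟩ := comp_mem_uniformity_sets hW₁
  obtain ⟨V, hV, hVW⟩ := exists_isUnifEnt_subset hZadd hW₂
  have key : ∀ a b c d e, (a, b) ∈ V → (b, c) ∈ V → (c, d) ∈ V → (d, e) ∈ V → (a, e) ∈ W :=
    fun a b c d e hab hbc hcd hde =>
      h₁ ⟨c, h₂ ⟨b, hVW hab, hVW hbc⟩, h₂ ⟨d, hVW hcd, hVW hde⟩⟩
  exact ⟨V, hV, fun p hp => key p.1 p.2 p.2 p.2 p.2 hp (hV.rfl _) (hV.rfl _) (hV.rfl _), key⟩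

theorem exists_isUnifEnt_sum (hZadd : UniformContinuous fun p : Z × Z => p.1 + p.2)
    {ι : Type*} (I : Finset ι) {W : Set (Z × Z)} (hW : W ∈ uniformity Z) :
    ∃ V, IsUnifEnt Z V ∧ ∀ u v : ι → Z, (∀ i ∈ I, (u i, v i) ∈ V) →
      (∑ i ∈ I, u i, ∑ i ∈ I, v i) ∈ W := by
  classical
  induction I using Finset.induction_on generalizing W with
  | empty =>
    obtain ⟨V, hV, -⟩ := exists_isUnifEnt_subset hZadd hW
    exact ⟨V, hV, fun u v _ => by simpa using refl_mem_uniformity hW⟩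
  | insert j I hj ih =>
    obtain ⟨V₁, hV₁, -, hc⟩ := exists_isUnifEnt_comp hZadd hW
    obtain ⟨V₂, hV₂, hs⟩ := ih hV₁.1
    obtain ⟨V, hV, hVs⟩ := exists_isUnifEnt_subset hZadd (Filter.inter_mem hV₁.1 hV₂.1)
    refine ⟨V, hV, fun u v h => ?_⟩
    rw [Finset.sum_insert hj, Finset.sum_insert hj]
    exact hc _ _ _ _ _ (hV₁.add_right (hVs (h j (Finset.mem_insert_self _ _))).1 _)
      (hV₁.add_left (hs u v fun i hi => (hVs (h i (Finset.mem_insert_of_mem hi))).2) _)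
      (hV₁.rfl _) (hV₁.rfl _)

theorem IsUnifEnt.mem_of_approx {W : Set (Z × Z)} (hW : IsUnifEnt Z W) {a b : Z}
    (h : ∀ V ∈ uniformity Z, ∃ a' b', (a', a) ∈ V ∧ (b', b) ∈ V ∧ (a', b') ∈ W) :
    (a, b) ∈ W := by
  rw [← hW.2.1.closure_eq, mem_closure_iff_nhds]
  intro t ht
  rw [nhds_prod_eq] at ht
  obtain ⟨s₁, hs₁, s₂, hs₂, hs⟩ := Filter.mem_prod_iff.1 ht
  obtain ⟨V₁, hV₁, -, h₁⟩ := UniformSpace.mem_nhds_iff_symm.1 hs₁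
  obtain ⟨V₂, hV₂, -, h₂⟩ := UniformSpace.mem_nhds_iff_symm.1 hs₂
  obtain ⟨a', b', ha, hb, hab⟩ := h (Prod.swap ⁻¹' (V₁ ∩ V₂))
    (tendsto_swap_uniformity (Filter.inter_mem hV₁ hV₂))
  exact ⟨(a', b'), hs ⟨h₁ ha.1, h₂ hb.2⟩, hab⟩

end UniformMonoid

section Support

variable {S : Type u} {X : Type v} [AddCommMonoid X] {𝒦 𝒢 : Set (Set S)} {ℱ : Set (S → X)}
  {ℬ : Set (Set X)} {f g : S → X} {α β : Set S} {x y : X}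

theorem SupportedBy.mono (h : SupportedBy 𝒦 f α) (hαβ : α ⊆ β) : SupportedBy 𝒦 f β := by
  obtain ⟨κ, hκ, hκα, h0⟩ := h
  exact ⟨κ, hκ, hκα.trans hαβ, h0⟩

theorem SupportedBy.eq_zero (h : SupportedBy 𝒦 f α) {s : S} (hs : s ∉ α) : f s = 0 := by
  obtain ⟨κ, -, hκα, h0⟩ := h
  exact h0 s fun h => hs (hκα h)

theorem EqualsOver.mono (h : EqualsOver 𝒢 f x β) (hαβ : α ⊆ β) : EqualsOver 𝒢 f x α := by
  obtain ⟨γ, hγ, hβγ, hx⟩ := h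
  exact ⟨γ, hγ, hαβ.trans hβγ, hx⟩

theorem FB_mono {B C : Set X} (hBC : B ⊆ C) : FB ℱ B ⊆ FB ℱ C :=
  fun _ h => ⟨h.1, h.2.trans hBC⟩

theorem BHull_subset {B : Set X} (hB : B ∈ ℬ) (hx : x ∈ B) : BHull ℬ x ⊆ B :=
  Set.sInter_subset_of_mem ⟨hB, hx⟩

theorem FStar_mono {κ κ' : Set S} {B C : Set X} (hκ : κ' ⊆ κ) (hαβ : α ⊆ β) (hBC : B ⊆ C) :
    FStar 𝒦 𝒢 ℱ x κ α B ⊆ FStar 𝒦 𝒢 ℱ x κ' β C :=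
  fun _ h => ⟨FB_mono hBC h.1, h.2.1.mono hκ, h.2.2.mono hαβ⟩

theorem mem_genField_of_mem_G {γ : Set S} (hγ : γ ∈ 𝒢) : γ ∈ genField 𝒦 𝒢 :=
  fun _ hE => hE.1 (Or.inr hγ)

theorem SWB_mono {Z : Type w} {ℓ : (S → X) → Z} {V W : Set (Z × Z)} {B C : Set X}
    (hVW : V ⊆ W) (hBC : B ⊆ C) {γ : Set S} (h : γ ∈ SWB 𝒦 𝒢 ℱ ℓ V C) :
    γ ∈ SWB 𝒦 𝒢 ℱ ℓ W B :=
  ⟨h.1, fun f hf g hg hs => hVW (h.2 f (FB_mono hBC hf) g (FB_mono hBC hg) hs)⟩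

theorem SWB_of_subset {Z : Type w} {ℓ : (S → X) → Z} {W : Set (Z × Z)} {B : Set X}
    {γ γ' : Set S} (h : γ ∈ SWB 𝒦 𝒢 ℱ ℓ W B) (hγ' : γ' ∈ 𝒢) (hs : γ' ⊆ γ) :
    γ' ∈ SWB 𝒦 𝒢 ℱ ℓ W B :=
  ⟨hγ', fun f hf g hg hg' => h.2 f hf g hg (hg'.mono hs)⟩

end Support

namespace RieszSystem

variable {S : Type u} {X : Type v} [AddCommMonoid X] [UniformSpace X]
  {𝒦 𝒢 : Set (Set S)} {ℬ : Set (Set X)} {ℱ : Set (S → X)} {𝒯 : Filter ((S → X) × (S → X))}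

theorem G_biUnion (h : RieszSystem 𝒦 𝒢 ℬ ℱ 𝒯) {ι : Type*} (I : Finset ι) (γ : ι → Set S)
    (hγ : ∀ i ∈ I, γ i ∈ 𝒢) : (⋃ i ∈ I, γ i) ∈ 𝒢 := by
  classical
  induction I using Finset.induction_on with
  | empty => simpa using h.G_empty
  | insert j I _ ih =>
    rw [Finset.set_biUnion_insert]
    exact h.G_union _ (hγ _ (Finset.mem_insert_self _ _)) _
      (ih fun i hi => hγ i (Finset.mem_insert_of_mem hi))

theorem K_biUnion (h : RieszSystem 𝒦 𝒢 ℬ ℱ 𝒯) {ι : Type*} (I : Finset ι) (κ : ι → Set S)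
    (hκ : ∀ i ∈ I, κ i ∈ 𝒦) : (⋃ i ∈ I, κ i) ∈ 𝒦 := by
  classical
  induction I using Finset.induction_on with
  | empty => simpa using h.K_empty
  | insert j I _ ih =>
    rw [Finset.set_biUnion_insert]
    exact h.K_union _ (hκ _ (Finset.mem_insert_self _ _)) _
      (ih fun i hi => hκ i (Finset.mem_insert_of_mem hi))

theorem univ_mem_G (h : RieszSystem 𝒦 𝒢 ℬ ℱ 𝒯) : Set.univ ∈ 𝒢 := by
  obtain ⟨G, hG, hU, -⟩ := h.F_partble 0 h.F_zero _ Filter.univ_mem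
  rw [← hU]
  exact h.G_biUnion G _ fun γ hγ => hG hγ

theorem compl_mem_G (h : RieszSystem 𝒦 𝒢 ℬ ℱ 𝒯) {κ : Set S} (hκ : κ ∈ 𝒦) : κᶜ ∈ 𝒢 := by
  rw [Set.compl_eq_univ_sdiff]
  exact (h.KG_diff κ hκ _ h.univ_mem_G).2

theorem K_inter (h : RieszSystem 𝒦 𝒢 ℬ ℱ 𝒯) {κ κ' : Set S} (hκ : κ ∈ 𝒦) (hκ' : κ' ∈ 𝒦) :
    κ ∩ κ' ∈ 𝒦 := by
  rw [← sdiff_compl]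
  exact (h.KG_diff κ hκ _ (h.compl_mem_G hκ')).1

/-- Disjoint members of `𝒦` have disjoint `𝒢`-neighbourhoods. -/
theorem exists_separating (h : RieszSystem 𝒦 𝒢 ℬ ℱ 𝒯) {κ₁ κ₂ γ : Set S} (h₁ : κ₁ ∈ 𝒦)
    (h₂ : κ₂ ∈ 𝒦) (hγ : γ ∈ 𝒢) (h₁γ : κ₁ ⊆ γ) (h₂γ : κ₂ ⊆ γ) (hd : Disjoint κ₁ κ₂) :
    ∃ γ₁ ∈ 𝒢, ∃ γ₂ ∈ 𝒢, κ₁ ⊆ γ₁ ∧ κ₂ ⊆ γ₂ ∧ γ₁ ⊆ γ ∧ γ₂ ⊆ γ ∧ Disjoint γ₁ γ₂ := by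
  obtain ⟨γ', hγ', κ', hκ', h₁γ', hγκ, hκγ⟩ := h.KG_interpose κ₁ h₁ (γ \ κ₂)
    (h.KG_diff κ₂ h₂ γ hγ).2 (Set.subset_sdiff.2 ⟨h₁γ, hd⟩)
  have hs := Set.subset_sdiff.1 hκγ
  exact ⟨γ', hγ', γ \ κ', (h.KG_diff κ' hκ' γ hγ).2, h₁γ', Set.subset_sdiff.2 ⟨h₂γ, hs.2.symm⟩,
    hγκ.trans hs.1, Set.sdiff_subset, Set.disjoint_sdiff_right.mono_left hγκ⟩

theorem supportedBy_zero (h : RieszSystem 𝒦 𝒢 ℬ ℱ 𝒯) (α : Set S) :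
    SupportedBy 𝒦 (0 : S → X) α :=
  ⟨∅, h.K_empty, Set.empty_subset _, fun _ _ => rfl⟩

theorem supportedBy_add (h : RieszSystem 𝒦 𝒢 ℬ ℱ 𝒯) {f g : S → X} {α : Set S}
    (hf : SupportedBy 𝒦 f α) (hg : SupportedBy 𝒦 g α) : SupportedBy 𝒦 (f + g) α := by
  obtain ⟨κ, hκ, hκα, hf0⟩ := hf
  obtain ⟨κ', hκ', hκα', hg0⟩ := hg
  refine ⟨κ ∪ κ', h.K_union _ hκ _ hκ', Set.union_subset hκα hκα', fun s hs => ?_⟩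
  rw [Pi.add_apply, hf0 s fun h => hs (Or.inl h), hg0 s fun h => hs (Or.inr h), add_zero]

theorem zero_mem_FB (h : RieszSystem 𝒦 𝒢 ℬ ℱ 𝒯) {B : Set X} (hB : B ∈ ℬ) :
    (0 : S → X) ∈ FB ℱ B :=
  ⟨h.F_zero, Set.range_subset_iff.2 fun _ => h.B_zero B hB⟩

theorem add_mem_FB (h : RieszSystem 𝒦 𝒢 ℬ ℱ 𝒯) {B B' C : Set X} (hC : B + B' ⊆ C)
    {f g : S → X} (hf : f ∈ FB ℱ B) (hg : g ∈ FB ℱ B') : f + g ∈ FB ℱ C :=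
  ⟨h.F_add _ hf.1 _ hg.1, Set.range_subset_iff.2 fun s =>
    hC (Set.add_mem_add (hf.2 ⟨s, rfl⟩) (hg.2 ⟨s, rfl⟩))⟩

theorem add_mem_FB_of_disjoint (h : RieszSystem 𝒦 𝒢 ℬ ℱ 𝒯) {B : Set X}
    {f g : S → X} {α β : Set S} (hf : f ∈ FB ℱ B) (hg : g ∈ FB ℱ B) (hfα : SupportedBy 𝒦 f α)
    (hgβ : SupportedBy 𝒦 g β) (hd : Disjoint α β) : f + g ∈ FB ℱ B := by
  refine ⟨h.F_add _ hf.1 _ hg.1, Set.range_subset_iff.2 fun s => ?_⟩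
  by_cases hs : s ∈ α
  · rw [Pi.add_apply, hgβ.eq_zero (hd.notMem_of_mem_left hs), add_zero]
    exact hf.2 ⟨s, rfl⟩
  · rw [Pi.add_apply, hfα.eq_zero hs, zero_add]
    exact hg.2 ⟨s, rfl⟩

theorem exists_add_subset (h : RieszSystem 𝒦 𝒢 ℬ ℱ 𝒯) {B : Set X} (hB : B ∈ ℬ) :
    ∃ C ∈ ℬ, B + B ⊆ C ∧ B ⊆ C := by
  obtain ⟨C, hC, hBC⟩ := h.B_add B hB B hB
  refine ⟨C, hC, hBC, fun x hx => hBC ?_⟩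
  simpa using Set.add_mem_add hx (h.B_zero B hB)

theorem FStar_nonempty (h : RieszSystem 𝒦 𝒢 ℬ ℱ 𝒯) {κ β : Set S} (hκ : κ ∈ 𝒦) (hβ : β ∈ 𝒢)
    (hκβ : κ ⊆ β) (x : X) : ∃ f, f ∈ FStar 𝒦 𝒢 ℱ x κ β (BHull ℬ x) := by
  obtain ⟨f, hf, hr, hs, he⟩ := h.F_urysohn κ hκ β hβ hκβ x
  exact ⟨f, ⟨hf, hr⟩, he, hs⟩

end RieszSystem

/-- The hypotheses shared by all facts on the set function `τ = τ_ℓ`. -/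
structure RieszTau {S : Type u} {X : Type v} {Z : Type w} [AddCommMonoid X] [UniformSpace X]
    [AddCommMonoid Z] [UniformSpace Z] (𝒦 𝒢 : Set (Set S)) (ℬ : Set (Set X))
    (ℱ : Set (S → X)) (𝒯 : Filter ((S → X) × (S → X))) (ℓ : (S → X) → Z)
    (τ : Set S → X → Z) : Prop where
  add : UniformContinuous fun p : Z × Z => p.1 + p.2
  sys : RieszSystem 𝒦 𝒢 ℬ ℱ 𝒯
  int : RieszIntegral 𝒦 𝒢 ℬ ℱ 𝒯 ℓ
  tau : IsTau 𝒦 𝒢 ℬ ℱ ℓ τ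

namespace RieszTau

variable {S : Type u} {X : Type v} {Z : Type w} [AddCommMonoid X] [UniformSpace X]
  [AddCommMonoid Z] [UniformSpace Z] {𝒦 𝒢 : Set (Set S)} {ℬ : Set (Set X)}
  {ℱ : Set (S → X)} {𝒯 : Filter ((S → X) × (S → X))} {ℓ : (S → X) → Z} {τ : Set S → X → Z}

/-- Inner regularity of `γ ∈ 𝒢` with respect to `ℓ`. -/
theorem exists_inner_SWB (h : RieszTau 𝒦 𝒢 ℬ ℱ 𝒯 ℓ τ) {B : Set X} (hB : B ∈ ℬ)
    {W : Set (Z × Z)} (hW : W ∈ uniformity Z) {γ κ₁ : Set S} (hγ : γ ∈ 𝒢) (hκ₁ : κ₁ ∈ 𝒦)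
    (hκγ : κ₁ ⊆ γ) : ∃ κ ∈ 𝒦, κ₁ ⊆ κ ∧ κ ⊆ γ ∧ γ \ κ ∈ SWB 𝒦 𝒢 ℱ ℓ W B := by
  obtain ⟨V, hV, hVW⟩ := exists_isUnifEnt_subset h.add hW
  by_contra! hcon
  have step : ∀ κ : {κ : Set S // κ ∈ 𝒦 ∧ κ₁ ⊆ κ ∧ κ ⊆ γ},
      ∃ p : Set S × {κ : Set S // κ ∈ 𝒦 ∧ κ₁ ⊆ κ ∧ κ ⊆ γ},
        p.1 ∈ 𝒢 ∧ Disjoint p.1 κ.1 ∧ κ.1 ⊆ p.2.1 ∧ p.1 ⊆ p.2.1 ∧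
        ∃ f ∈ FB ℱ B, ∃ g ∈ FB ℱ B, SupportedBy 𝒦 g p.1 ∧ (ℓ f, ℓ (f + g)) ∉ V := by
    rintro ⟨κ, hκ, h1, h2⟩
    have hd := (h.sys.KG_diff κ hκ γ hγ).2
    have hnot := hcon κ hκ h1 h2
    have : ∃ f ∈ FB ℱ B, ∃ g ∈ FB ℱ B, SupportedBy 𝒦 g (γ \ κ) ∧ (ℓ f, ℓ (f + g)) ∉ V := by
      by_contra! hc
      exact hnot ⟨hd, fun f hf g hg hs => hVW (hc f hf g hg hs)⟩
    obtain ⟨f, hf, g, hg, ⟨κg, hκg, hκgs, hg0⟩, hfg⟩ := this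
    obtain ⟨γ', hγ', κ', hκ', h3, h4, h5⟩ := h.sys.KG_interpose κg hκg _ hd hκgs
    have h5' := Set.subset_sdiff.1 h5
    exact ⟨(γ', ⟨κ ∪ κ', h.sys.K_union _ hκ _ hκ', h1.trans Set.subset_union_left,
      Set.union_subset h2 h5'.1⟩), hγ', h5'.2.mono_left h4, Set.subset_union_left,
      h4.trans Set.subset_union_right, f, hf, g, hg, ⟨κg, hκg, h3, hg0⟩, hfg⟩
  choose next hnext using step
  let seq : ℕ → {κ : Set S // κ ∈ 𝒦 ∧ κ₁ ⊆ κ ∧ κ ⊆ γ} :=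
    fun n => Nat.rec ⟨κ₁, hκ₁, subset_rfl, hκγ⟩ (fun _ κ => (next κ).2) n
  have hseq : Monotone fun n => (seq n).1 := monotone_nat_of_le_succ fun n => (hnext (seq n)).2.2.1
  have hlt : ∀ m n, m < n → Disjoint (next (seq m)).1 (next (seq n)).1 := fun m n hmn =>
    ((hnext (seq n)).2.1.mono_right
      (((hnext (seq m)).2.2.2.1).trans (hseq (Nat.succ_le_of_lt hmn)))).symm
  obtain ⟨m, hm⟩ := h.int.2.1 B hB V hV (fun n => (next (seq n)).1) (fun n => (hnext _).1)
    fun m n hmn => (lt_or_gt_of_ne hmn).elim (hlt m n) fun hl => (hlt n m hl).symm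
  obtain ⟨f, hf, g, hg, hs, hfg⟩ := (hnext (seq (m + 1))).2.2.2.2
  exact hfg (hm (m + 1) (Nat.lt_succ_self m) f hf g hg hs)

/-- Outer regularity of `κ ∈ 𝒦` with respect to `ℓ`. -/
theorem exists_outer_SWB (h : RieszTau 𝒦 𝒢 ℬ ℱ 𝒯 ℓ τ) {B : Set X} (hB : B ∈ ℬ)
    {W : Set (Z × Z)} (hW : W ∈ uniformity Z) {γ κ : Set S} (hγ : γ ∈ 𝒢) (hκ : κ ∈ 𝒦)
    (hκγ : κ ⊆ γ) : ∃ β ∈ 𝒢, κ ⊆ β ∧ β ⊆ γ ∧ β \ κ ∈ SWB 𝒦 𝒢 ℱ ℓ W B := by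
  obtain ⟨κ', hκ', -, hs, hsm⟩ := h.exists_inner_SWB hB hW (h.sys.KG_diff κ hκ γ hγ).2
    h.sys.K_empty (Set.empty_subset _)
  refine ⟨γ \ κ', (h.sys.KG_diff κ' hκ' γ hγ).2,
    Set.subset_sdiff.2 ⟨hκγ, (Set.subset_sdiff.1 hs).2.symm⟩, Set.sdiff_subset, ?_⟩
  rwa [sdiff_right_comm]

/-- Functions that agree near `κ` and are supported by `γ` have close values if `γ \ κ` is
small. -/
theorem exists_compare (h : RieszTau 𝒦 𝒢 ℬ ℱ 𝒯 ℓ τ) {B : Set X} (hB : B ∈ ℬ)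
    {W : Set (Z × Z)} (hW : W ∈ uniformity Z) :
    ∃ V ∈ uniformity Z, ∃ C ∈ ℬ, B + B ⊆ C ∧ B ⊆ C ∧ ∀ κ ∈ 𝒦, ∀ γ ∈ 𝒢, κ ⊆ γ →
      γ \ κ ∈ SWB 𝒦 𝒢 ℱ ℓ V C → ∀ f ∈ FB ℱ B, ∀ g ∈ FB ℱ B, SupportedBy 𝒦 f γ →
      SupportedBy 𝒦 g γ → (∃ ω ∈ 𝒢, κ ⊆ ω ∧ ω ⊆ γ ∧ ∀ s ∈ ω, f s = g s) →
      ∀ k ∈ FB ℱ B, (ℓ (k + f), ℓ (k + g)) ∈ W := by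
  obtain ⟨V, hV, -, hVW⟩ := exists_isUnifEnt_comp h.add hW
  obtain ⟨C₁, hC₁, hBC₁, hBC₁'⟩ := h.sys.exists_add_subset hB
  obtain ⟨C, hC, hCC, hCC'⟩ := h.sys.exists_add_subset hC₁
  obtain ⟨T, hT, hTV⟩ := (h.int.2.2 C hC).1 V hV.1
  obtain ⟨T', hT', hTT⟩ := h.sys.T_add T hT
  obtain ⟨U, hU, hext⟩ := h.sys.F_ext B hB T' hT'
  refine ⟨V, hV.1, C, hC, hBC₁.trans hCC', hBC₁'.trans hCC', ?_⟩
  rintro κ hκ γ hγ hκγ hsm f hf g hg hfγ hgγ ⟨ω, hω, hκω, hωγ, hfg⟩ k hk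
  obtain ⟨p, hp, q, hq, hps, hqs, hpq⟩ := hext κ hκ γ hγ hκγ f hf g hg hfγ hgγ
    ⟨ω, hω, hκω, hωγ, fun s hs => hfg s hs ▸ refl_mem_uniformity hU⟩
  have hBC : FB ℱ B ⊆ FB ℱ C₁ := FB_mono hBC₁'
  have hkf := h.sys.add_mem_FB hBC₁ hk hf
  have hkg := h.sys.add_mem_FB hBC₁ hk hg
  have h1 := hsm.2 _ (FB_mono hCC' hkf) p (FB_mono hCC' (hBC hp)) hps
  have h2 := hsm.2 _ (FB_mono hCC' hkg) q (FB_mono hCC' (hBC hq)) hqs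
  have h3 := hTT _ _ _ _ (h.sys.T_refl T' hT' k hk.1) hpq
  rw [← add_assoc, ← add_assoc] at h3
  have h4 := hTV _ (h.sys.add_mem_FB hCC hkf (hBC hp)) _ (h.sys.add_mem_FB hCC hkg (hBC hq)) h3
  exact hVW _ _ _ _ _ h1 h4 (hV.symm h2) (hV.rfl _)

theorem exists_SWB_union (h : RieszTau 𝒦 𝒢 ℬ ℱ 𝒯 ℓ τ) {B : Set X} (hB : B ∈ ℬ)
    {W : Set (Z × Z)} (hW : W ∈ uniformity Z) :
    ∃ V ∈ uniformity Z, ∃ C ∈ ℬ, ∀ γ₁ ∈ SWB 𝒦 𝒢 ℱ ℓ V C, ∀ γ₂ ∈ SWB 𝒦 𝒢 ℱ ℓ V C,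
      γ₁ ∪ γ₂ ∈ SWB 𝒦 𝒢 ℱ ℓ W B := by
  classical
  obtain ⟨W₀, hW₀, hW₀W, hc⟩ := exists_isUnifEnt_comp h.add hW
  obtain ⟨V, hV, C, hC, hBC, hBC', hcomp⟩ := h.exists_compare hB hW₀.1
  refine ⟨W₀, hW₀.1, C, hC, fun γ₁ h₁ γ₂ h₂ => ?_⟩
  rcases eq_or_ne γ₁ γ₂ with rfl | hne
  · rw [Set.union_self]
    exact SWB_mono hW₀W hBC' h₁
  have hU := h.sys.G_union _ h₁.1 _ h₂.1
  refine ⟨hU, ?_⟩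
  rintro f hf g hg ⟨κ₀, hκ₀, hκ₀U, hg0⟩
  obtain ⟨κ, hκ, hκ₀κ, hκU, hsm⟩ := h.exists_inner_SWB hC hV hU hκ₀ hκ₀U
  obtain ⟨ω, hω, κ₁, hκ₁, hκω, hωκ, hκ₁U⟩ := h.sys.KG_interpose κ hκ _ hU hκU
  obtain ⟨φ, hφ, hJ, hsum⟩ := h.sys.F_partunity B hB {γ₁, γ₂}
    (by simp [Set.insert_subset_iff, h₁.1, h₂.1]) κ₁ hκ₁ (by simpa using hκ₁U) g hg
  have hφ₁ := hφ γ₁ (by simp)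
  have hφ₂ := hφ γ₂ (by simp)
  have hJ' := hJ _ subset_rfl
  rw [Finset.sum_pair hne] at hJ'
  have e1 := hcomp κ hκ _ hU hκU hsm g hg _ hJ' ⟨κ₀, hκ₀, hκ₀U, hg0⟩
    (h.sys.supportedBy_add (hφ₁.2.mono Set.subset_union_left)
      (hφ₂.2.mono Set.subset_union_right))
    ⟨ω, hω, hκω, hωκ.trans hκ₁U, fun s hs => by
      rw [hsum s (hωκ hs), Finset.sum_pair hne, Pi.add_apply]⟩ f hf
  have e2 := h₁.2 f (FB_mono hBC' hf) _ (FB_mono hBC' hφ₁.1) hφ₁.2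
  have e3 := h₂.2 _ (h.sys.add_mem_FB hBC hf hφ₁.1) _ (FB_mono hBC' hφ₂.1) hφ₂.2
  rw [add_assoc] at e3
  exact hc _ _ _ _ _ e2 e3 (hW₀.symm e1) (hW₀.rfl _)

/-- `τ κ x` is the limit of `ℓ` over `ℱ*(x,κ,β,B)` for every `B ∈ ℬ` containing `x`. -/
theorem exists_tau_approx (h : RieszTau 𝒦 𝒢 ℬ ℱ 𝒯 ℓ τ) {B : Set X} (hB : B ∈ ℬ)
    {W : Set (Z × Z)} (hW : W ∈ uniformity Z) {κ : Set S} (hκ : κ ∈ 𝒦) {x : X} (hx : x ∈ B) :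
    ∃ β ∈ 𝒢, κ ⊆ β ∧ ∀ f ∈ FStar 𝒦 𝒢 ℱ x κ β B, (ℓ f, τ κ x) ∈ W := by
  obtain ⟨W₀, hW₀, -, hc⟩ := exists_isUnifEnt_comp h.add hW
  obtain ⟨V, hV, C, hC, hBC, hBC', hcomp⟩ := h.exists_compare hB hW₀.1
  obtain ⟨β₀, hβ₀, hκβ₀, himg⟩ := h.tau κ hκ x _ (UniformSpace.ball_mem_nhds (τ κ x) hW₀.1)
  obtain ⟨β, hβ, hκβ, hββ₀, hsm⟩ := h.exists_outer_SWB hC hV hβ₀ hκ hκβ₀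
  refine ⟨β, hβ, hκβ, fun f hf => ?_⟩
  obtain ⟨g, hg⟩ := h.sys.FStar_nonempty hκ hβ hκβ x
  have hgB : g ∈ FStar 𝒦 𝒢 ℱ x κ β B := FStar_mono subset_rfl subset_rfl (BHull_subset hB hx) hg
  have hgτ : (τ κ x, ℓ g) ∈ W₀ := himg ⟨g, FStar_mono subset_rfl hββ₀ subset_rfl hg, rfl⟩
  obtain ⟨ω₁, hω₁, hκω₁, hf1⟩ := hf.2.1
  obtain ⟨ω₂, hω₂, hκω₂, hg2⟩ := hg.2.1
  have := hcomp κ hκ β hβ hκβ hsm f hf.1 g hgB.1 hf.2.2 hg.2.2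
    ⟨ω₁ ∩ ω₂ ∩ β, h.sys.G_inter _ (h.sys.G_inter _ hω₁ _ hω₂) _ hβ,
      Set.subset_inter (Set.subset_inter hκω₁ hκω₂) hκβ, Set.inter_subset_right,
      fun s hs => (hf1 s hs.1.1).trans (hg2 s hs.1.2).symm⟩ 0 (h.sys.zero_mem_FB hB)
  rw [zero_add, zero_add] at this
  exact hc _ _ _ _ _ this (hW₀.symm hgτ) (hW₀.rfl _) (hW₀.rfl _)

theorem exists_tau_close (h : RieszTau 𝒦 𝒢 ℬ ℱ 𝒯 ℓ τ) {B : Set X} (hB : B ∈ ℬ)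
    {W : Set (Z × Z)} (hW : W ∈ uniformity Z) :
    ∃ V ∈ uniformity Z, ∃ C ∈ ℬ, ∀ κ ∈ 𝒦, ∀ κ' ∈ 𝒦, κ ⊆ κ' → ∀ θ ∈ SWB 𝒦 𝒢 ℱ ℓ V C,
      κ' \ κ ⊆ θ → ∀ x ∈ B, (τ κ' x, τ κ x) ∈ W := by
  obtain ⟨W₀, hW₀, -, hc⟩ := exists_isUnifEnt_comp h.add hW
  obtain ⟨V₁, hV₁, C₁, hC₁, -, -, hcomp⟩ := h.exists_compare hB hW₀.1
  obtain ⟨V, hV, C, hC, hunion⟩ := h.exists_SWB_union hC₁ hV₁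
  refine ⟨V, hV, C, hC, fun κ hκ κ' hκ' hκκ' θ hθ hsub x hx => ?_⟩
  obtain ⟨β₂, hβ₂, hκβ₂, hτ₂⟩ := h.exists_tau_approx hB hW₀.1 hκ' hx
  obtain ⟨β₃, hβ₃, hκβ₃, hτ₃⟩ := h.exists_tau_approx hB hW₀.1 hκ hx
  obtain ⟨β, hβ, hκβ, hββ₂, hsm⟩ := h.exists_outer_SWB hC hV hβ₂ hκ' hκβ₂
  have hβ₄ := h.sys.G_inter _ hβ _ hβ₃
  have hκβ₄ : κ ⊆ β ∩ β₃ := Set.subset_inter (hκκ'.trans hκβ) hκβ₃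
  obtain ⟨f, hf⟩ := h.sys.FStar_nonempty hκ' hβ hκβ x
  obtain ⟨g, hg⟩ := h.sys.FStar_nonempty hκ hβ₄ hκβ₄ x
  replace hf := FStar_mono subset_rfl subset_rfl (BHull_subset hB hx) hf
  replace hg := FStar_mono subset_rfl subset_rfl (BHull_subset hB hx) hg
  have hdiff : β \ κ ∈ SWB 𝒦 𝒢 ℱ ℓ V₁ C₁ := by
    refine SWB_of_subset (hunion _ hsm _ hθ) (h.sys.KG_diff κ hκ β hβ).2 fun s hs => ?_
    by_cases hsκ : s ∈ κ'
    · exact Or.inr (hsub ⟨hsκ, hs.2⟩)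
    · exact Or.inl ⟨hs.1, hsκ⟩
  obtain ⟨ω₁, hω₁, hκω₁, hf1⟩ := hf.2.1
  obtain ⟨ω₂, hω₂, hκω₂, hg2⟩ := hg.2.1
  have := hcomp κ hκ β hβ (hκκ'.trans hκβ) hdiff f hf.1 g hg.1 hf.2.2
    (hg.2.2.mono Set.inter_subset_left)
    ⟨ω₁ ∩ ω₂ ∩ β, h.sys.G_inter _ (h.sys.G_inter _ hω₁ _ hω₂) _ hβ,
      Set.subset_inter (Set.subset_inter (hκκ'.trans hκω₁) hκω₂) (hκκ'.trans hκβ),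
      Set.inter_subset_right,
      fun s hs => (hf1 s hs.1.1).trans (hg2 s hs.1.2).symm⟩ 0 (h.sys.zero_mem_FB hB)
  rw [zero_add, zero_add] at this
  exact hc _ _ _ _ _ (hW₀.symm (hτ₂ f (FStar_mono subset_rfl hββ₂ subset_rfl hf))) this
    (hτ₃ g (FStar_mono subset_rfl Set.inter_subset_right subset_rfl hg)) (hW₀.rfl _)

theorem map_add_of_disjoint (h : RieszTau 𝒦 𝒢 ℬ ℱ 𝒯 ℓ τ) {f g : S → X} (hf : f ∈ ℱ)
    (hg : g ∈ ℱ) {γ₁ γ₂ : Set S} (h₁ : γ₁ ∈ 𝒢) (h₂ : γ₂ ∈ 𝒢) (hfs : SupportedBy 𝒦 f γ₁)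
    (hgs : SupportedBy 𝒦 g γ₂) (hd : Disjoint γ₁ γ₂) : ℓ (f + g) = ℓ f + ℓ g :=
  h.int.1 f hf g hg
    ⟨γ₁, mem_genField_of_mem_G h₁, γ₂, mem_genField_of_mem_G h₂, hd, hfs, hgs⟩

theorem tau_union [T2Space Z] (h : RieszTau 𝒦 𝒢 ℬ ℱ 𝒯 ℓ τ) {κ₁ κ₂ : Set S} (h₁ : κ₁ ∈ 𝒦)
    (h₂ : κ₂ ∈ 𝒦) (hd : Disjoint κ₁ κ₂) (x : X) : τ (κ₁ ∪ κ₂) x = τ κ₁ x + τ κ₂ x := by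
  obtain ⟨B, hB, hx⟩ := h.sys.B_cover x
  refine eq_of_uniformity fun {W} hW => ?_
  obtain ⟨V, hV, -, hc⟩ := exists_isUnifEnt_comp h.add hW
  obtain ⟨β, hβ, hκβ, hβτ⟩ := h.exists_tau_approx hB hV.1 (h.sys.K_union _ h₁ _ h₂) hx
  obtain ⟨β₁, hβ₁, hκβ₁, hβτ₁⟩ := h.exists_tau_approx hB hV.1 h₁ hx
  obtain ⟨β₂, hβ₂, hκβ₂, hβτ₂⟩ := h.exists_tau_approx hB hV.1 h₂ hx
  obtain ⟨γ₁, hγ₁, γ₂, hγ₂, hκγ₁, hκγ₂, hγβ₁, hγβ₂, hγd⟩ := h.sys.exists_separating h₁ h₂ hβ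
    (Set.subset_union_left.trans hκβ) (Set.subset_union_right.trans hκβ) hd
  obtain ⟨f, hf⟩ := h.sys.FStar_nonempty h₁ (h.sys.G_inter _ hγ₁ _ hβ₁)
    (Set.subset_inter hκγ₁ hκβ₁) x
  obtain ⟨g, hg⟩ := h.sys.FStar_nonempty h₂ (h.sys.G_inter _ hγ₂ _ hβ₂)
    (Set.subset_inter hκγ₂ hκβ₂) x
  replace hf := FStar_mono subset_rfl subset_rfl (BHull_subset hB hx) hf
  replace hg := FStar_mono subset_rfl subset_rfl (BHull_subset hB hx) hg
  have hfs := hf.2.2.mono Set.inter_subset_left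
  have hgs := hg.2.2.mono Set.inter_subset_left
  have hfg : f + g ∈ FStar 𝒦 𝒢 ℱ x (κ₁ ∪ κ₂) β B := by
    refine ⟨h.sys.add_mem_FB_of_disjoint hf.1 hg.1 hfs hgs hγd, ?_,
      h.sys.supportedBy_add (hfs.mono hγβ₁) (hgs.mono hγβ₂)⟩
    obtain ⟨ω₁, hω₁, hκω₁, hf1⟩ := hf.2.1
    obtain ⟨ω₂, hω₂, hκω₂, hg2⟩ := hg.2.1
    refine ⟨ω₁ ∩ γ₁ ∪ ω₂ ∩ γ₂, h.sys.G_union _ (h.sys.G_inter _ hω₁ _ hγ₁) _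
      (h.sys.G_inter _ hω₂ _ hγ₂), Set.union_subset_union (Set.subset_inter hκω₁ hκγ₁)
      (Set.subset_inter hκω₂ hκγ₂), ?_⟩
    rintro s (⟨hs, hs'⟩ | ⟨hs, hs'⟩)
    · rw [Pi.add_apply, hf1 s hs, hgs.eq_zero (hγd.notMem_of_mem_left hs'), add_zero]
    · rw [Pi.add_apply, hg2 s hs, hfs.eq_zero (hγd.notMem_of_mem_right hs'), zero_add]
  have e := hβτ _ hfg
  have e₁ := hβτ₁ f (FStar_mono subset_rfl Set.inter_subset_right subset_rfl hf)
  have e₂ := hβτ₂ g (FStar_mono subset_rfl Set.inter_subset_right subset_rfl hg)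
  rw [h.map_add_of_disjoint hf.1.1 hg.1.1 hγ₁ hγ₂ hfs hgs hγd] at e
  exact hc _ _ _ _ _ (hV.symm e) (hV.add_right e₁ _) (hV.add_left e₂ _) (hV.rfl _)

theorem tau_empty [T2Space Z] (h : RieszTau 𝒦 𝒢 ℬ ℱ 𝒯 ℓ τ) (x : X) : τ ∅ x = ℓ 0 := by
  obtain ⟨B, hB, hx⟩ := h.sys.B_cover x
  refine (eq_of_uniformity fun {W} hW => ?_).symm
  obtain ⟨β, -, -, hβτ⟩ := h.exists_tau_approx hB hW h.sys.K_empty hx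
  exact hβτ 0 ⟨h.sys.zero_mem_FB hB, ⟨∅, h.sys.G_empty, subset_rfl, fun s hs => hs.elim⟩,
    h.sys.supportedBy_zero _⟩

theorem tau_zero [T2Space Z] (h : RieszTau 𝒦 𝒢 ℬ ℱ 𝒯 ℓ τ) {κ : Set S} (hκ : κ ∈ 𝒦) :
    τ κ 0 = ℓ 0 := by
  obtain ⟨B, hB, hx⟩ := h.sys.B_cover 0
  refine (eq_of_uniformity fun {W} hW => ?_).symm
  obtain ⟨β, hβ, hκβ, hβτ⟩ := h.exists_tau_approx hB hW hκ hx
  exact hβτ 0 ⟨h.sys.zero_mem_FB hB, ⟨β, hβ, hκβ, fun _ _ => rfl⟩, h.sys.supportedBy_zero _⟩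

theorem map_zero_add_tau [T2Space Z] (h : RieszTau 𝒦 𝒢 ℬ ℱ 𝒯 ℓ τ) {κ : Set S} (hκ : κ ∈ 𝒦)
    (x : X) : ℓ 0 + τ κ x = τ κ x := by
  rw [← h.tau_empty x, ← h.tau_union h.sys.K_empty hκ (Set.empty_disjoint _),
    Set.empty_union]

theorem map_zero_add_map_zero [T2Space Z] (h : RieszTau 𝒦 𝒢 ℬ ℱ 𝒯 ℓ τ) : ℓ 0 + ℓ 0 = ℓ 0 := by
  simpa only [h.tau_empty] using h.map_zero_add_tau h.sys.K_empty 0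

/-- Approximate additivity of `τ` when a member of `𝒦` is split into a member of `𝒦` and the
remainder. -/
theorem exists_tau_split [T2Space Z] (h : RieszTau 𝒦 𝒢 ℬ ℱ 𝒯 ℓ τ) {B : Set X} (hB : B ∈ ℬ)
    {W : Set (Z × Z)} (hW : W ∈ uniformity Z) {κ κ' κ₁ : Set S} (hκ : κ ∈ 𝒦) (hκ' : κ' ∈ 𝒦)
    (hκ₁ : κ₁ ∈ 𝒦) (hκκ' : κ ⊆ κ') (hκ₁s : κ₁ ⊆ κ' \ κ) :
    ∃ κ'' ∈ 𝒦, κ₁ ⊆ κ'' ∧ κ'' ⊆ κ' \ κ ∧ ∀ x ∈ B, (τ κ' x, τ κ x + τ κ'' x) ∈ W := by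
  obtain ⟨V, hV, C, hC, hclose⟩ := h.exists_tau_close hB hW
  obtain ⟨κ₀, hκ₀, hκ₁κ₀, hκ₀s, hsm⟩ := h.exists_inner_SWB hC hV (h.sys.compl_mem_G hκ) hκ₁
    fun s hs => (hκ₁s hs).2
  have hi := h.sys.K_inter hκ' hκ₀
  have hsub : κ' ∩ κ₀ ⊆ κ' \ κ := fun s hs => ⟨hs.1, hκ₀s hs.2⟩
  refine ⟨κ' ∩ κ₀, hi, Set.subset_inter (hκ₁s.trans Set.sdiff_subset) hκ₁κ₀, hsub,
    fun x hx => ?_⟩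
  rw [← h.tau_union hκ hi (Set.disjoint_sdiff_right.mono_right hsub)]
  refine hclose _ (h.sys.K_union _ hκ _ hi) _ hκ'
    (Set.union_subset hκκ' Set.inter_subset_left) _ hsm ?_ x hx
  rintro s ⟨hs, hs'⟩
  exact ⟨fun hsκ => hs' (Or.inl hsκ), fun hsκ => hs' (Or.inr ⟨hs, hsκ⟩)⟩

theorem exists_sum_approx (h : RieszTau 𝒦 𝒢 ℬ ℱ 𝒯 ℓ τ) {B : Set X} (hB : B ∈ ℬ)
    {ι : Type*} (I : Finset ι) (κ : ι → Set S) (hκ : ∀ i ∈ I, κ i ∈ 𝒦)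
    (hd : ∀ i ∈ I, ∀ j ∈ I, i ≠ j → Disjoint (κ i) (κ j)) (x y : ι → X)
    (hx : ∀ i ∈ I, x i ∈ B) (hy : ∀ i ∈ I, y i ∈ B) {W : Set (Z × Z)} (hW : W ∈ uniformity Z)
    {γ : Set S} (hγ : γ ∈ 𝒢) (hκγ : ∀ i ∈ I, κ i ⊆ γ) :
    ∃ f ∈ FB ℱ B, ∃ g ∈ FB ℱ B, SupportedBy 𝒦 f γ ∧ SupportedBy 𝒦 g γ ∧
      (ℓ f, ℓ 0 + ∑ i ∈ I, τ (κ i) (x i)) ∈ W ∧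
      (ℓ (f + g), ℓ 0 + ∑ i ∈ I, τ (κ i) (x i + y i)) ∈ W := by
  classical
  induction I using Finset.induction_on generalizing W γ with
  | empty =>
    have h0 := h.sys.zero_mem_FB hB
    exact ⟨0, h0, 0, h0, h.sys.supportedBy_zero _, h.sys.supportedBy_zero _,
      by simpa using refl_mem_uniformity hW, by simpa using refl_mem_uniformity hW⟩
  | insert j I hj ih =>
    have hjm := Finset.mem_insert_self j I
    have him : ∀ i ∈ I, i ∈ insert j I := fun i => Finset.mem_insert_of_mem
    obtain ⟨V, hV, -, hc⟩ := exists_isUnifEnt_comp h.add hW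
    obtain ⟨C, hC, hBC, -⟩ := h.sys.exists_add_subset hB
    have hdj : Disjoint (κ j) (⋃ i ∈ I, κ i) := by
      simp only [Set.disjoint_iUnion_right]
      exact fun i hi => hd j hjm i (him i hi) fun e => hj (e ▸ hi)
    obtain ⟨γ₁, hγ₁, γ₂, hγ₂, hκγ₁, hκγ₂, hγγ₁, hγγ₂, hγd⟩ := h.sys.exists_separating (hκ j hjm)
      (h.sys.K_biUnion I κ fun i hi => hκ i (him i hi)) hγ (hκγ j hjm)
      (Set.iUnion₂_subset fun i hi => hκγ i (him i hi)) hdj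
    obtain ⟨f₂, hf₂, g₂, hg₂, hfs₂, hgs₂, hfe₂, hge₂⟩ := ih (fun i hi => hκ i (him i hi))
      (fun i hi k hk => hd i (him i hi) k (him k hk)) (fun i hi => hx i (him i hi))
      (fun i hi => hy i (him i hi)) hV.1 hγ₂
      (fun i hi => (Set.subset_iUnion₂ (s := fun i _ => κ i) i hi).trans hκγ₂)
    obtain ⟨β₁, hβ₁, hκβ₁, hτ₁⟩ := h.exists_tau_approx hB hV.1 (hκ j hjm) (hx j hjm)
    obtain ⟨β₂, hβ₂, hκβ₂, hτ₂⟩ := h.exists_tau_approx hC hV.1 (hκ j hjm)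
      (hBC (Set.add_mem_add (hx j hjm) (hy j hjm)))
    have hβ := h.sys.G_inter _ hγ₁ _ (h.sys.G_inter _ hβ₁ _ hβ₂)
    have hκβ := Set.subset_inter hκγ₁ (Set.subset_inter hκβ₁ hκβ₂)
    obtain ⟨f₁, hf₁⟩ := h.sys.FStar_nonempty (hκ j hjm) hβ hκβ (x j)
    obtain ⟨g₁, hg₁⟩ := h.sys.FStar_nonempty (hκ j hjm) hβ hκβ (y j)
    replace hf₁ := FStar_mono subset_rfl subset_rfl (BHull_subset hB (hx j hjm)) hf₁
    replace hg₁ := FStar_mono subset_rfl subset_rfl (BHull_subset hB (hy j hjm)) hg₁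
    have hfg₁ : f₁ + g₁ ∈ FStar 𝒦 𝒢 ℱ (x j + y j) (κ j) β₂ C := by
      obtain ⟨ω₁, hω₁, hκω₁, hf1⟩ := hf₁.2.1
      obtain ⟨ω₂, hω₂, hκω₂, hg2⟩ := hg₁.2.1
      exact ⟨h.sys.add_mem_FB hBC hf₁.1 hg₁.1, ⟨ω₁ ∩ ω₂, h.sys.G_inter _ hω₁ _ hω₂,
        Set.subset_inter hκω₁ hκω₂, fun s hs => by rw [Pi.add_apply, hf1 s hs.1, hg2 s hs.2]⟩,
        (h.sys.supportedBy_add hf₁.2.2 hg₁.2.2).mono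
          (Set.inter_subset_right.trans Set.inter_subset_right)⟩
    have hfs₁ := hf₁.2.2.mono Set.inter_subset_left
    have hgs₁ := hg₁.2.2.mono Set.inter_subset_left
    refine ⟨f₁ + f₂, h.sys.add_mem_FB_of_disjoint hf₁.1 hf₂ hfs₁ hfs₂ hγd,
      g₁ + g₂, h.sys.add_mem_FB_of_disjoint hg₁.1 hg₂ hgs₁ hgs₂ hγd,
      h.sys.supportedBy_add (hfs₁.mono hγγ₁) (hfs₂.mono hγγ₂),
      h.sys.supportedBy_add (hgs₁.mono hγγ₁) (hgs₂.mono hγγ₂), ?_, ?_⟩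
    · rw [h.map_add_of_disjoint hf₁.1.1 hf₂.1 hγ₁ hγ₂ hfs₁ hfs₂ hγd, Finset.sum_insert hj,
        add_left_comm]
      exact hc _ _ _ _ _ (hV.add_right (hτ₁ f₁ (FStar_mono subset_rfl
        (Set.inter_subset_right.trans Set.inter_subset_left) subset_rfl hf₁)) _)
        (hV.add_left hfe₂ _) (hV.rfl _) (hV.rfl _)
    · rw [add_add_add_comm, h.map_add_of_disjoint hfg₁.1.1 (h.sys.F_add _ hf₂.1 _ hg₂.1) hγ₁ hγ₂
        (h.sys.supportedBy_add hfs₁ hgs₁) (h.sys.supportedBy_add hfs₂ hgs₂) hγd,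
        Finset.sum_insert hj, add_left_comm]
      exact hc _ _ _ _ _ (hV.add_right (hτ₂ _ hfg₁) _) (hV.add_left hge₂ _) (hV.rfl _)
        (hV.rfl _)

theorem wSmall_of_mem_SWB [T2Space Z] (h : RieszTau 𝒦 𝒢 ℬ ℱ 𝒯 ℓ τ) {B : Set X} (hB : B ∈ ℬ)
    {W : Set (Z × Z)} (hW : IsUnifEnt Z W) {γ : Set S} (hγ : γ ∈ SWB 𝒦 𝒢 ℱ ℓ W B) :
    WSmall 𝒦 𝒢 τ B W γ := by
  classical
  refine ⟨γ, hγ.1, subset_rfl, fun K hK hd hKγ x y hx hy => ?_⟩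
  rcases K.eq_empty_or_nonempty with rfl | ⟨κ, hκ⟩
  · simpa using hW.rfl 0
  have habs : ∀ u : Set S → X, ∑ κ ∈ K, τ κ (u κ) = ℓ 0 + ∑ κ ∈ K, τ κ (u κ) := fun u => by
    rw [← Finset.add_sum_erase K _ hκ, ← add_assoc, h.map_zero_add_tau (hK hκ)]
  rw [habs x, habs fun κ => x κ + y κ]
  refine hW.mem_of_approx fun V hV => ?_
  obtain ⟨f, hf, g, hg, -, hgs, hfe, hge⟩ := h.exists_sum_approx hB K id (fun κ hκ => hK hκ) hd
    x y hx hy hV hγ.1 hKγ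
  exact ⟨_, _, hfe, hge, hγ.2 f hf g hg hgs⟩

/-- Smallness in terms of finite disjoint indexed families, in which the empty set may be
repeated. -/
theorem exists_indexed_of_wSmall [T2Space Z] (h : RieszTau 𝒦 𝒢 ℬ ℱ 𝒯 ℓ τ) {B : Set X}
    {W : Set (Z × Z)} (hW : IsUnifEnt Z W) {α : Set S} (hα : WSmall 𝒦 𝒢 τ B W α) :
    ∃ γ ∈ 𝒢, α ⊆ γ ∧ ∀ {ι : Type u} (I : Finset ι) (κ : ι → Set S), (∀ i ∈ I, κ i ∈ 𝒦) →
      (∀ i ∈ I, ∀ j ∈ I, i ≠ j → Disjoint (κ i) (κ j)) → (∀ i ∈ I, κ i ⊆ γ) →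
      ∀ x y : ι → X, (∀ i ∈ I, x i ∈ B) → (∀ i ∈ I, y i ∈ B) →
      (∑ i ∈ I, τ (κ i) (x i), ∑ i ∈ I, τ (κ i) (x i + y i)) ∈ W := by
  classical
  obtain ⟨γ, hγ, hαγ, hsm⟩ := hα
  refine ⟨γ, hγ, hαγ, fun {ι} I κ hκ hd hκγ x y hx hy => ?_⟩
  let J := I.filter fun i => κ i ≠ ∅
  have hJI : ∀ i ∈ J, i ∈ I := fun i hi => (Finset.mem_filter.1 hi).1
  have hinj : Set.InjOn κ J := fun i hi j hj hij => by
    by_contra hne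
    have hdis := hd i (hJI i hi) j (hJI j hj) hne
    rw [← hij, disjoint_self] at hdis
    exact (Finset.mem_filter.1 hi).2 hdis
  let e : (ι → X) → Set S → X := fun u s =>
    if hs : ∃ i ∈ J, κ i = s then u hs.choose else 0
  have he : ∀ u : ι → X, ∀ i ∈ J, e u (κ i) = u i := fun u i hi => by
    have hs : ∃ k ∈ J, κ k = κ i := ⟨i, hi, rfl⟩
    have : hs.choose = i := hinj hs.choose_spec.1 hi hs.choose_spec.2
    simp only [e, dif_pos hs, this]
  have hrest : ∀ u : ι → X, ∑ i ∈ I with ¬κ i ≠ ∅, τ (κ i) (u i) =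
      ∑ i ∈ I with ¬κ i ≠ ∅, ℓ 0 := fun u => by
    refine Finset.sum_congr rfl fun i hi => ?_
    rw [not_not.1 (Finset.mem_filter.1 hi).2, h.tau_empty]
  have key := hsm (J.image κ)
    (by
      intro s hs
      obtain ⟨i, hi, rfl⟩ := Finset.mem_image.1 hs
      exact hκ i (hJI i hi))
    (by
      intro s hs t ht hst
      obtain ⟨i, hi, rfl⟩ := Finset.mem_image.1 hs
      obtain ⟨j, hj, rfl⟩ := Finset.mem_image.1 ht
      exact hd i (hJI i hi) j (hJI j hj) fun hij => hst (hij ▸ rfl))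
    (by
      intro s hs
      obtain ⟨i, hi, rfl⟩ := Finset.mem_image.1 hs
      exact hκγ i (hJI i hi))
    (e x) (e y)
    (by
      intro s hs
      obtain ⟨i, hi, rfl⟩ := Finset.mem_image.1 hs
      rw [he x i hi]
      exact hx i (hJI i hi))
    (by
      intro s hs
      obtain ⟨i, hi, rfl⟩ := Finset.mem_image.1 hs
      rw [he y i hi]
      exact hy i (hJI i hi))
  have hx' : ∑ i ∈ J, τ (κ i) (e x (κ i)) = ∑ i ∈ J, τ (κ i) (x i) :=
    Finset.sum_congr rfl fun i hi => by rw [he x i hi]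
  have hxy' : ∑ i ∈ J, τ (κ i) (e x (κ i) + e y (κ i)) = ∑ i ∈ J, τ (κ i) (x i + y i) :=
    Finset.sum_congr rfl fun i hi => by rw [he x i hi, he y i hi]
  rw [Finset.sum_image hinj, Finset.sum_image hinj, hx', hxy'] at key
  rw [← Finset.sum_filter_add_sum_filter_not I (fun i => κ i ≠ ∅) fun i => τ (κ i) (x i),
    ← Finset.sum_filter_add_sum_filter_not I (fun i => κ i ≠ ∅) fun i => τ (κ i) (x i + y i),
    hrest x, hrest fun i => x i + y i]
  exact hW.add_right key _

theorem exists_wSmall_union [T2Space Z] (h : RieszTau 𝒦 𝒢 ℬ ℱ 𝒯 ℓ τ) {B : Set X} (hB : B ∈ ℬ)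
    {W : Set (Z × Z)} (hW : W ∈ uniformity Z) :
    ∃ V, IsUnifEnt Z V ∧ V ⊆ W ∧ ∀ α₁ α₂ : Set S, WSmall 𝒦 𝒢 τ B V α₁ →
      WSmall 𝒦 𝒢 τ B V α₂ → WSmall 𝒦 𝒢 τ B W (α₁ ∪ α₂) := by
  obtain ⟨V, hV, hVW, hc⟩ := exists_isUnifEnt_comp h.add hW
  refine ⟨V, hV, hVW, fun α₁ α₂ h₁ h₂ => ?_⟩
  obtain ⟨γ₁, hγ₁, hα₁, hsm₁⟩ := h.exists_indexed_of_wSmall hV h₁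
  obtain ⟨γ₂, hγ₂, hα₂, hsm₂⟩ := h.exists_indexed_of_wSmall hV h₂
  refine ⟨γ₁ ∪ γ₂, h.sys.G_union _ hγ₁ _ hγ₂, Set.union_subset_union hα₁ hα₂,
    fun K hK hd hKγ x y hx hy => ?_⟩
  obtain ⟨C, hC, hBC, hBC'⟩ := h.sys.exists_add_subset hB
  obtain ⟨V', hV', hsum⟩ := exists_isUnifEnt_sum h.add K hV.1
  have hsplit : ∀ κ ∈ K, ∃ b ∈ 𝒦, b ⊆ κ \ (κ \ γ₂) ∧
      ∀ x ∈ C, (τ κ x, τ (κ \ γ₂) x + τ b x) ∈ V' := fun κ hκ => by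
    obtain ⟨b, hb, -, hbs, hbe⟩ := h.exists_tau_split hC hV'.1
      (h.sys.KG_diff κ (hK hκ) γ₂ hγ₂).1 (hK hκ) h.sys.K_empty Set.sdiff_subset
      (Set.empty_subset _)
    exact ⟨b, hb, hbs, hbe⟩
  choose! b hb hbs hbe using hsplit
  have e₁ := hsm₁ K (fun κ => κ \ γ₂) (fun κ hκ => (h.sys.KG_diff κ (hK hκ) γ₂ hγ₂).1)
    (fun i hi j hj hij => (hd i hi j hj hij).mono Set.sdiff_subset Set.sdiff_subset)
    (fun κ hκ s hs => (hKγ κ hκ hs.1).resolve_right hs.2) x y hx hy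
  have e₂ := hsm₂ K b hb
    (fun i hi j hj hij => (hd i hi j hj hij).mono ((hbs i hi).trans Set.sdiff_subset)
      ((hbs j hj).trans Set.sdiff_subset))
    (fun κ hκ s hs => by
      by_contra hs'
      exact (hbs κ hκ hs).2 ⟨(hbs κ hκ hs).1, hs'⟩) x y hx hy
  have e₃ := hsum (fun κ => τ κ (x κ)) (fun κ => τ (κ \ γ₂) (x κ) + τ (b κ) (x κ))
    fun κ hκ => hbe κ hκ _ (hBC' (hx κ hκ))
  have e₄ := hsum (fun κ => τ κ (x κ + y κ))
    (fun κ => τ (κ \ γ₂) (x κ + y κ) + τ (b κ) (x κ + y κ))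
    fun κ hκ => hbe κ hκ _ (hBC (Set.add_mem_add (hx κ hκ) (hy κ hκ)))
  rw [Finset.sum_add_distrib] at e₃ e₄
  exact hc _ _ _ _ _ e₃ (hV.add_right e₁ _) (hV.add_left e₂ _) (hV.symm e₄)

theorem tau_mem_of_wSmall [T2Space Z] (h : RieszTau 𝒦 𝒢 ℬ ℱ 𝒯 ℓ τ) {B : Set X} (hB : B ∈ ℬ)
    {W : Set (Z × Z)} {α κ : Set S} (hα : WSmall 𝒦 𝒢 τ B W α) (hκ : κ ∈ 𝒦) (hκα : κ ⊆ α)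
    {x : X} (hx : x ∈ B) : (ℓ 0, τ κ x) ∈ W := by
  obtain ⟨γ, -, hαγ, hsm⟩ := hα
  have := hsm {κ} (by simpa using hκ) (by simp [PairwiseDisjFinset])
    (by simpa using hκα.trans hαγ) 0 (fun _ => x) (fun _ _ => h.sys.B_zero B hB) fun _ _ => hx
  simpa [h.tau_zero hκ] using this

end RieszTau

theorem WSmall.mono {S : Type u} {X : Type v} {Z : Type w} [AddCommMonoid X] [AddCommMonoid Z]
    {𝒦 𝒢 : Set (Set S)} {h : Set S → X → Z} {B : Set X} {V W : Set (Z × Z)} {α β : Set S}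
    (hβ : WSmall 𝒦 𝒢 h B V β) (hVW : V ⊆ W) (hαβ : α ⊆ β) : WSmall 𝒦 𝒢 h B W α := by
  obtain ⟨γ, hγ, hβγ, hsm⟩ := hβ
  exact ⟨γ, hγ, hαβ.trans hβγ, fun K hK hd hKγ x y hx hy => hVW (hsm K hK hd hKγ x y hx hy)⟩

namespace RieszTau

variable {S : Type u} {X : Type v} {Z : Type w} [AddCommMonoid X] [UniformSpace X]
  [AddCommMonoid Z] [UniformSpace Z] [T2Space Z] {𝒦 𝒢 : Set (Set S)} {ℬ : Set (Set X)}
  {ℱ : Set (S → X)} {𝒯 : Filter ((S → X) × (S → X))} {ℓ : (S → X) → Z}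
  {τ ξ ν : Set S → X → Z}

theorem exists_inner_wSmall (h : RieszTau 𝒦 𝒢 ℬ ℱ 𝒯 ℓ τ) {B : Set X} (hB : B ∈ ℬ)
    {V : Set (Z × Z)} (hV : IsUnifEnt Z V) {γ : Set S} (hγ : γ ∈ 𝒢) :
    ∃ κ ∈ 𝒦, κ ⊆ γ ∧ WSmall 𝒦 𝒢 τ B V (γ \ κ) := by
  obtain ⟨κ, hκ, -, hκγ, hsm⟩ := h.exists_inner_SWB hB hV.1 hγ h.sys.K_empty (Set.empty_subset _)
  exact ⟨κ, hκ, hκγ, h.wSmall_of_mem_SWB hB hV hsm⟩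

theorem exists_outer_wSmall (h : RieszTau 𝒦 𝒢 ℬ ℱ 𝒯 ℓ τ) {B : Set X} (hB : B ∈ ℬ)
    {V : Set (Z × Z)} (hV : IsUnifEnt Z V) {κ : Set S} (hκ : κ ∈ 𝒦) :
    ∃ γ ∈ 𝒢, κ ⊆ γ ∧ WSmall 𝒦 𝒢 τ B V (γ \ κ) := by
  obtain ⟨γ, hγ, hκγ, -, hsm⟩ := h.exists_outer_SWB hB hV.1 h.sys.univ_mem_G hκ
    (Set.subset_univ _)
  exact ⟨γ, hγ, hκγ, h.wSmall_of_mem_SWB hB hV hsm⟩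

theorem mem_RSet_of_mem_K (h : RieszTau 𝒦 𝒢 ℬ ℱ 𝒯 ℓ τ) {κ : Set S} (hκ : κ ∈ 𝒦) :
    κ ∈ RSet 𝒦 𝒢 ℬ τ := fun B hB V hV => by
  obtain ⟨γ, hγ, hκγ, hsm⟩ := h.exists_outer_wSmall hB hV hκ
  exact ⟨κ, hκ, γ, hγ, subset_rfl, hκγ, hsm⟩

theorem mem_RSet_of_mem_G (h : RieszTau 𝒦 𝒢 ℬ ℱ 𝒯 ℓ τ) {γ : Set S} (hγ : γ ∈ 𝒢) :
    γ ∈ RSet 𝒦 𝒢 ℬ τ := fun B hB V hV => by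
  obtain ⟨κ, hκ, hκγ, hsm⟩ := h.exists_inner_wSmall hB hV hγ
  exact ⟨κ, hκ, γ, hγ, hκγ, subset_rfl, hsm⟩

theorem isSetField_RSet (h : RieszTau 𝒦 𝒢 ℬ ℱ 𝒯 ℓ τ) : IsSetField (RSet 𝒦 𝒢 ℬ τ) := by
  refine ⟨h.mem_RSet_of_mem_G h.sys.univ_mem_G, fun α hα B hB W hW => ?_,
    fun α₁ h₁ α₂ h₂ B hB W hW => ?_⟩ <;>
  obtain ⟨V, hV, -, hun⟩ := h.exists_wSmall_union hB hW.1
  · obtain ⟨κ, hκ, γ, hγ, hκα, hαγ, hsm⟩ := hα B hB V hV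
    obtain ⟨κ₀, hκ₀, -, hsm₀⟩ := h.exists_inner_wSmall hB hV h.sys.univ_mem_G
    refine ⟨κ₀ \ γ, (h.sys.KG_diff κ₀ hκ₀ γ hγ).1, κᶜ, h.sys.compl_mem_G hκ,
      fun s hs hsα => hs.2 (hαγ hsα), Set.compl_subset_compl.2 hκα,
      (hun _ _ hsm hsm₀).mono subset_rfl ?_⟩
    rintro s ⟨hs, hs'⟩
    by_cases hsγ : s ∈ γ
    · exact Or.inl ⟨hsγ, hs⟩
    · exact Or.inr ⟨trivial, fun hsκ => hs' ⟨hsκ, hsγ⟩⟩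
  · obtain ⟨κ₁, hκ₁, γ₁, hγ₁, hκα₁, hαγ₁, hsm₁⟩ := h₁ B hB V hV
    obtain ⟨κ₂, hκ₂, γ₂, hγ₂, hκα₂, hαγ₂, hsm₂⟩ := h₂ B hB V hV
    refine ⟨κ₁ ∪ κ₂, h.sys.K_union _ hκ₁ _ hκ₂, γ₁ ∪ γ₂, h.sys.G_union _ hγ₁ _ hγ₂,
      Set.union_subset_union hκα₁ hκα₂, Set.union_subset_union hαγ₁ hαγ₂,
      (hun _ _ hsm₁ hsm₂).mono subset_rfl ?_⟩
    rintro s ⟨hs | hs, hs'⟩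
    · exact Or.inl ⟨hs, fun hsκ => hs' (Or.inl hsκ)⟩
    · exact Or.inr ⟨hs, fun hsκ => hs' (Or.inr hsκ)⟩

theorem exists_xi_approx (h : RieszTau 𝒦 𝒢 ℬ ℱ 𝒯 ℓ τ) (hξ : IsXi 𝒦 𝒢 τ ξ) {γ : Set S}
    (hγ : γ ∈ 𝒢) (x : X) {W : Set (Z × Z)} (hW : IsUnifEnt Z W) :
    ∃ κ₁ ∈ 𝒦, κ₁ ⊆ γ ∧ ∀ κ ∈ 𝒦, κ₁ ⊆ κ → κ ⊆ γ → (τ κ x, ξ γ x) ∈ W := by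
  have : Nonempty {κ : Set S // κ ∈ 𝒦 ∧ κ ⊆ γ} := ⟨⟨∅, h.sys.K_empty, Set.empty_subset _⟩⟩
  have : IsDirectedOrder {κ : Set S // κ ∈ 𝒦 ∧ κ ⊆ γ} :=
    ⟨fun a b => ⟨⟨a.1 ∪ b.1, h.sys.K_union _ a.2.1 _ b.2.1, Set.union_subset a.2.2 b.2.2⟩,
      Set.subset_union_left (s := a.1), Set.subset_union_right (s := a.1)⟩⟩
  obtain ⟨⟨κ₁, hκ₁, hκ₁γ⟩, hev⟩ :=
    Filter.mem_atTop_sets.1 (hξ γ hγ x (UniformSpace.ball_mem_nhds (ξ γ x) hW.1))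
  exact ⟨κ₁, hκ₁, hκ₁γ, fun κ hκ h₁ h₂ => hW.symm (hev ⟨κ, hκ, h₂⟩ h₁)⟩

theorem exists_xi_close (h : RieszTau 𝒦 𝒢 ℬ ℱ 𝒯 ℓ τ) (hξ : IsXi 𝒦 𝒢 τ ξ) {B : Set X}
    (hB : B ∈ ℬ) {W : Set (Z × Z)} (hW : W ∈ uniformity Z) :
    ∃ V, IsUnifEnt Z V ∧ ∀ κ ∈ 𝒦, ∀ γ ∈ 𝒢, κ ⊆ γ → WSmall 𝒦 𝒢 τ B V (γ \ κ) →
      ∀ x ∈ B, (τ κ x, ξ γ x) ∈ W := by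
  obtain ⟨V, hV, -, hc⟩ := exists_isUnifEnt_comp h.add hW
  refine ⟨V, hV, fun κ hκ γ hγ hκγ hsm x hx => ?_⟩
  obtain ⟨κ₁, hκ₁, hκ₁γ, hap⟩ := h.exists_xi_approx hξ hγ x hV
  have hU := h.sys.K_union _ hκ _ hκ₁
  have hUγ := Set.union_subset hκγ hκ₁γ
  obtain ⟨κ₂, hκ₂, -, hκ₂s, hsplit⟩ := h.exists_tau_split hB hV.1 hκ hU h.sys.K_empty
    Set.subset_union_left (Set.empty_subset _)
  have e := hV.add_left (h.tau_mem_of_wSmall hB hsm hκ₂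
    (hκ₂s.trans (Set.sdiff_subset_sdiff_left hUγ)) hx) (τ κ x)
  rw [add_comm, h.map_zero_add_tau hκ] at e
  exact hc _ _ _ _ _ e (hV.symm (hsplit x hx)) (hap _ hU Set.subset_union_right hUγ) (hV.rfl _)

/-- `τ` is `s`-bounded on disjoint sequences in `𝒦`. -/
theorem exists_tau_mem_of_disjoint (h : RieszTau 𝒦 𝒢 ℬ ℱ 𝒯 ℓ τ) {B : Set X} (hB : B ∈ ℬ)
    {W : Set (Z × Z)} (hW : W ∈ uniformity Z) (κ : ℕ → Set S) (hκ : ∀ n, κ n ∈ 𝒦)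
    (hd : ∀ m n, m ≠ n → Disjoint (κ m) (κ n)) : ∃ n, ∀ x ∈ B, (ℓ 0, τ (κ n) x) ∈ W := by
  obtain ⟨V, hV, -, hc⟩ := exists_isUnifEnt_comp h.add hW
  choose next hnext hnext_sub hnext_un using
    fun E : {E : Set (Z × Z) // IsUnifEnt Z E} => h.exists_wSmall_union hB E.2.1
  let E : ℕ → {E : Set (Z × Z) // IsUnifEnt Z E} :=
    fun n => Nat.rec ⟨V, hV⟩ (fun _ E => ⟨next E, hnext E⟩) n
  choose ω hω hκω hωsm using fun n => h.exists_outer_wSmall hB (E (n + 1)).2 (hκ n)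
  have hfin : ∀ j k (α : Set S), (∀ s ∈ α, ∃ i ≤ j, s ∈ ω (k + i) \ κ (k + i)) →
      WSmall 𝒦 𝒢 τ B (E k).1 α := by
    intro j
    induction j with
    | zero =>
      intro k α hα
      refine (hωsm k).mono (hnext_sub (E k)) fun s hs => ?_
      obtain ⟨i, hi, his⟩ := hα s hs
      rwa [Nat.le_zero.1 hi] at his
    | succ j ih =>
      intro k α hα
      refine (hnext_un (E k) _ (α \ (ω k \ κ k)) (hωsm k)
        (ih (k + 1) _ fun s hs => ?_)).mono subset_rfl fun s hs => ?_
      · obtain ⟨i, hi, his⟩ := hα s hs.1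
        rcases i with - | i
        · exact absurd his hs.2
        · exact ⟨i, Nat.le_of_succ_le_succ hi, by rwa [Nat.add_right_comm, Nat.add_assoc]⟩
      · by_cases hs' : s ∈ ω k \ κ k
        · exact Or.inl hs'
        · exact Or.inr ⟨hs, hs'⟩
  choose ω' hω' κ' hκ' hκω' hωκ' hκω'' using
    fun n => h.sys.KG_interpose (κ n) (hκ n) (ω n) (hω n) (hκω n)
  have hGlt : ∀ m n, m < n → Disjoint (ω' m \ ⋃ i ∈ Finset.range m, κ' i)
      (ω' n \ ⋃ i ∈ Finset.range n, κ' i) := fun m n hmn =>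
    Set.disjoint_left.2 fun s hs hs' => hs'.2
      (Set.mem_biUnion (Finset.mem_coe.2 (Finset.mem_range.2 hmn)) (hωκ' m hs.1))
  obtain ⟨m, hm⟩ := h.int.2.1 B hB V hV (fun n => ω' n \ ⋃ i ∈ Finset.range n, κ' i)
    (fun n => (h.sys.KG_diff _ (h.sys.K_biUnion _ κ' fun i _ => hκ' i) _ (hω' n)).2)
    fun m n hmn => (lt_or_gt_of_ne hmn).elim (hGlt m n) fun hl => (hGlt n m hl).symm
  let n := m + 1
  have hO := h.sys.G_biUnion (Finset.range n) ω fun i _ => hω i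
  have hκO := (h.sys.KG_diff _ (hκ n) _ hO).1
  have hGsm : WSmall 𝒦 𝒢 τ B V (ω' n \ ⋃ i ∈ Finset.range n, κ' i) :=
    h.wSmall_of_mem_SWB hB hV
      ⟨(h.sys.KG_diff _ (h.sys.K_biUnion _ κ' fun i _ => hκ' i) _ (hω' n)).2,
        hm n (Nat.lt_succ_self m)⟩
  obtain ⟨κ₃, hκ₃, -, hκ₃s, hsplit⟩ := h.exists_tau_split hB hV.1 hκO (hκ n) h.sys.K_empty
    Set.sdiff_subset (Set.empty_subset _)
  have hsm₃ : WSmall 𝒦 𝒢 τ B V κ₃ := hfin n 0 κ₃ fun s hs => by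
    obtain ⟨hsn, hs'⟩ := hκ₃s hs
    have hsO : s ∈ ⋃ i ∈ Finset.range n, ω i := by
      by_contra hcon
      exact hs' ⟨hsn, hcon⟩
    obtain ⟨i, hi, his⟩ := Set.mem_iUnion₂.1 hsO
    have hin := Finset.mem_range.1 hi
    refine ⟨i, hin.le, ?_⟩
    rw [Nat.zero_add]
    exact ⟨his, (hd n i hin.ne').notMem_of_mem_left hsn⟩
  refine ⟨n, fun x hx => ?_⟩
  have e₁ := h.tau_mem_of_wSmall hB hGsm hκO (fun s hs => ⟨hκω' n hs.1, fun hs' => by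
    obtain ⟨i, hi, his⟩ := Set.mem_iUnion₂.1 hs'
    exact hs.2 (Set.mem_biUnion (Finset.mem_coe.2 hi) (hκω'' i his))⟩) hx
  have e₂ := h.tau_mem_of_wSmall hB hsm₃ hκ₃ subset_rfl hx
  have e₃ := hV.add_right e₁ (ℓ 0)
  rw [h.map_zero_add_map_zero] at e₃
  exact hc _ _ _ _ _ e₃ (hV.add_left e₂ _) (hV.symm (hsplit x hx)) (hV.rfl _)

theorem exists_xi_diff (h : RieszTau 𝒦 𝒢 ℬ ℱ 𝒯 ℓ τ) (hξ : IsXi 𝒦 𝒢 τ ξ)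
    {W : Set (Z × Z)} (hW : W ∈ uniformity Z) :
    ∃ V, IsUnifEnt Z V ∧ ∀ γ ∈ 𝒢, ∀ γ' ∈ 𝒢, γ' ⊆ γ → ∀ x,
      (∀ κ ∈ 𝒦, κ ⊆ γ \ γ' → (ℓ 0, τ κ x) ∈ V) → (ξ γ' x, ξ γ x) ∈ W := by
  obtain ⟨V, hV, -, hc⟩ := exists_isUnifEnt_comp h.add hW
  refine ⟨V, hV, fun γ hγ γ' hγ' hγγ x hsm => ?_⟩
  obtain ⟨B, hB, hx⟩ := h.sys.B_cover x
  obtain ⟨κ₁, hκ₁, hκ₁γ, hap₁⟩ := h.exists_xi_approx hξ hγ' x hV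
  obtain ⟨κ₂, hκ₂, hκ₂γ, hap₂⟩ := h.exists_xi_approx hξ hγ x hV
  have hκ := h.sys.K_union _ hκ₁ _ hκ₂
  have hκγ := Set.union_subset (hκ₁γ.trans hγγ) hκ₂γ
  have hd := (h.sys.KG_diff _ hκ γ' hγ').1
  obtain ⟨κ₃, hκ₃, hκ₁₃, hκ₃s, hsplit⟩ := h.exists_tau_split hB hV.1 hd hκ hκ₁
    Set.sdiff_subset fun s hs => ⟨Or.inl hs, fun hs' => hs'.2 (hκ₁γ hs)⟩
  have hκ₃γ : κ₃ ⊆ γ' := fun s hs => by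
    by_contra hs'
    exact (hκ₃s hs).2 ⟨(hκ₃s hs).1, hs'⟩
  have e := hV.add_right (hsm _ hd (Set.sdiff_subset_sdiff_left hκγ)) (τ κ₃ x)
  rw [h.map_zero_add_tau hκ₃] at e
  exact hc _ _ _ _ _ (hV.symm (hap₁ _ hκ₃ hκ₁₃ hκ₃γ)) e (hV.symm (hsplit x hx))
    (hap₂ _ hκ Set.subset_union_right hκγ)

/-- The net of the `ξ γ` for `γ ∈ 𝒢` containing `α` is uniformly Cauchy on `B`. -/
theorem exists_xi_cauchy (h : RieszTau 𝒦 𝒢 ℬ ℱ 𝒯 ℓ τ) (hξ : IsXi 𝒦 𝒢 τ ξ) {B : Set X}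
    (hB : B ∈ ℬ) (α : Set S) {W : Set (Z × Z)} (hW : W ∈ uniformity Z) :
    ∃ γ ∈ 𝒢, α ⊆ γ ∧ ∀ γ' ∈ 𝒢, α ⊆ γ' → γ' ⊆ γ → ∀ x ∈ B, (ξ γ' x, ξ γ x) ∈ W := by
  obtain ⟨V, hV, hdiff⟩ := h.exists_xi_diff hξ hW
  by_contra! hcon
  have step : ∀ γ : {γ : Set S // γ ∈ 𝒢 ∧ α ⊆ γ}, ∃ p : {γ : Set S // γ ∈ 𝒢 ∧ α ⊆ γ} × Set S,
      p.1.1 ⊆ γ.1 ∧ p.2 ∈ 𝒦 ∧ p.2 ⊆ γ.1 \ p.1.1 ∧ ∃ x ∈ B, (ℓ 0, τ p.2 x) ∉ V := by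
    rintro ⟨γ, hγ, hαγ⟩
    obtain ⟨γ', hγ', hαγ', hγγ, x, hx, hξx⟩ := hcon γ hγ hαγ
    by_contra! hc
    exact hξx (hdiff γ hγ γ' hγ' hγγ x fun κ hκ hκs =>
      hc (⟨γ', hγ', hαγ'⟩, κ) hγγ hκ hκs x hx)
  choose next hnext using step
  let seq : ℕ → {γ : Set S // γ ∈ 𝒢 ∧ α ⊆ γ} :=
    fun n => Nat.rec ⟨Set.univ, h.sys.univ_mem_G, Set.subset_univ _⟩ (fun _ γ => (next γ).1) n
  have hseq : Antitone fun n => (seq n).1 := antitone_nat_of_succ_le fun n => (hnext (seq n)).1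
  have hlt : ∀ m n, m < n → Disjoint (next (seq m)).2 (next (seq n)).2 := fun m n hmn =>
    Set.disjoint_left.2 fun s hs hs' => ((hnext (seq m)).2.2.1 hs).2
      (hseq (Nat.succ_le_of_lt hmn) ((hnext (seq n)).2.2.1 hs').1)
  obtain ⟨n, hn⟩ := h.exists_tau_mem_of_disjoint hB hV.1 (fun n => (next (seq n)).2)
    (fun n => (hnext (seq n)).2.1)
    fun m n hmn => (lt_or_gt_of_ne hmn).elim (hlt m n) fun hl => (hlt n m hl).symm
  obtain ⟨x, hx, hnot⟩ := (hnext (seq n)).2.2.2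
  exact hnot (hn x hx)

theorem xi_mem_closure (h : RieszTau 𝒦 𝒢 ℬ ℱ 𝒯 ℓ τ) (hξ : IsXi 𝒦 𝒢 τ ξ) {B : Set X}
    (hB : B ∈ ℬ) {γ : Set S} (hγ : γ ∈ 𝒢) {x : X} (hx : x ∈ B) :
    ξ γ x ∈ closure (ℓ '' FB ℱ B) := by
  rw [UniformSpace.mem_closure_iff_ball]
  intro W hW
  obtain ⟨V, hV, -, hc⟩ := exists_isUnifEnt_comp h.add hW
  obtain ⟨κ, hκ, hκγ, hap⟩ := h.exists_xi_approx hξ hγ x hV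
  obtain ⟨β, hβ, hκβ, hβτ⟩ := h.exists_tau_approx hB hV.1 hκ hx
  obtain ⟨f, hf⟩ := h.sys.FStar_nonempty hκ hβ hκβ x
  replace hf := FStar_mono subset_rfl subset_rfl (BHull_subset hB hx) hf
  exact ⟨ℓ f, hc _ _ _ _ _ (hV.symm (hap κ hκ subset_rfl hκγ)) (hV.symm (hβτ f hf)) (hV.rfl _)
    (hV.rfl _), f, hf.1, rfl⟩

theorem atBot_isDirected (h : RieszTau 𝒦 𝒢 ℬ ℱ 𝒯 ℓ τ) (α : Set S) :
    Nonempty {γ : Set S // γ ∈ 𝒢 ∧ α ⊆ γ} ∧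
      IsCodirectedOrder {γ : Set S // γ ∈ 𝒢 ∧ α ⊆ γ} :=
  ⟨⟨⟨Set.univ, h.sys.univ_mem_G, Set.subset_univ _⟩⟩,
    ⟨fun a b => ⟨⟨a.1 ∩ b.1, h.sys.G_inter _ a.2.1 _ b.2.1, Set.subset_inter a.2.2 b.2.2⟩,
      Set.inter_subset_left (s := a.1), Set.inter_subset_right (s := a.1)⟩⟩⟩

theorem exists_nu (h : RieszTau 𝒦 𝒢 ℬ ℱ 𝒯 ℓ τ) (hξ : IsXi 𝒦 𝒢 τ ξ) :
    ∃ ν : Set S → X → Z, IsNu 𝒢 ξ ν := by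
  have hlim : ∀ (α : Set S) (x : X), ∃ z, GAboveLim 𝒢 α ξ x z := fun α x => by
    obtain ⟨B, hB, hx⟩ := h.sys.B_cover x
    obtain ⟨_, _⟩ := h.atBot_isDirected α
    obtain ⟨z, -, hz⟩ := (h.int.2.2 B hB).2
      (Filter.map (fun γ : {γ : Set S // γ ∈ 𝒢 ∧ α ⊆ γ} => ξ γ.1 x) atBot)
      (cauchy_iff.2 ⟨inferInstance, fun W hW => by
        obtain ⟨V, hV, -, hc⟩ := exists_isUnifEnt_comp h.add hW
        obtain ⟨γ, hγ, hαγ, hγξ⟩ := h.exists_xi_cauchy hξ hB α hV.1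
        refine ⟨{z | (z, ξ γ x) ∈ V}, Filter.mem_map.2 (Filter.mem_atBot_sets.2
          ⟨⟨γ, hγ, hαγ⟩, fun γ' hγ' => hγξ γ'.1 γ'.2.1 γ'.2.2 hγ' x hx⟩), ?_⟩
        rintro ⟨a, b⟩ ⟨ha, hb⟩
        exact hc _ _ _ _ _ ha (hV.symm hb) (hV.rfl _) (hV.rfl _)⟩)
      (Filter.le_principal_iff.2 (Filter.mem_map.2 (Filter.univ_mem' fun γ =>
        h.xi_mem_closure hξ hB γ.2.1 hx)))
    exact ⟨z, hz⟩
  choose ν hν using hlim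
  exact ⟨ν, hν⟩

theorem exists_nu_approx (h : RieszTau 𝒦 𝒢 ℬ ℱ 𝒯 ℓ τ) (hν : IsNu 𝒢 ξ ν) (α : Set S) (x : X)
    {W : Set (Z × Z)} (hW : IsUnifEnt Z W) :
    ∃ γ₀ ∈ 𝒢, α ⊆ γ₀ ∧ ∀ γ ∈ 𝒢, α ⊆ γ → γ ⊆ γ₀ → (ξ γ x, ν α x) ∈ W := by
  obtain ⟨_, _⟩ := h.atBot_isDirected α
  obtain ⟨⟨γ₀, hγ₀, hαγ₀⟩, hev⟩ :=
    Filter.mem_atBot_sets.1 (hν α x (UniformSpace.ball_mem_nhds (ν α x) hW.1))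
  exact ⟨γ₀, hγ₀, hαγ₀, fun γ hγ h₁ h₂ => hW.symm (hev ⟨γ, hγ, h₁⟩ h₂)⟩

theorem exists_nu_close (h : RieszTau 𝒦 𝒢 ℬ ℱ 𝒯 ℓ τ) (hξ : IsXi 𝒦 𝒢 τ ξ) (hν : IsNu 𝒢 ξ ν)
    {B : Set X} (hB : B ∈ ℬ) {W : Set (Z × Z)} (hW : W ∈ uniformity Z) :
    ∃ V, IsUnifEnt Z V ∧ ∀ κ ∈ 𝒦, ∀ γ ∈ 𝒢, ∀ ρ, κ ⊆ ρ → ρ ⊆ γ → WSmall 𝒦 𝒢 τ B V (γ \ κ) →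
      ∀ x ∈ B, (τ κ x, ν ρ x) ∈ W := by
  obtain ⟨V₀, hV₀, -, hc⟩ := exists_isUnifEnt_comp h.add hW
  obtain ⟨V, hV, hclose⟩ := h.exists_xi_close hξ hB hV₀.1
  refine ⟨V, hV, fun κ hκ γ hγ ρ hκρ hργ hsm x hx => ?_⟩
  obtain ⟨γ₀, hγ₀, hργ₀, hap⟩ := h.exists_nu_approx hν ρ x hV₀
  have hi := h.sys.G_inter _ hγ _ hγ₀
  have hρi := Set.subset_inter hργ hργ₀
  exact hc _ _ _ _ _ (hclose κ hκ _ hi (hκρ.trans hρi)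
    (hsm.mono subset_rfl (Set.sdiff_subset_sdiff_left Set.inter_subset_left)) x hx)
    (hap _ hi hρi Set.inter_subset_right) (hV₀.rfl _) (hV₀.rfl _)

theorem nu_eq_tau (h : RieszTau 𝒦 𝒢 ℬ ℱ 𝒯 ℓ τ) (hξ : IsXi 𝒦 𝒢 τ ξ) (hν : IsNu 𝒢 ξ ν)
    {κ : Set S} (hκ : κ ∈ 𝒦) (x : X) : ν κ x = τ κ x := by
  obtain ⟨B, hB, hx⟩ := h.sys.B_cover x
  refine (eq_of_uniformity fun {W} hW => ?_).symm
  obtain ⟨V, hV, hclose⟩ := h.exists_nu_close hξ hν hB hW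
  obtain ⟨γ, hγ, hκγ, hsm⟩ := h.exists_outer_wSmall hB hV hκ
  exact hclose κ hκ γ hγ κ subset_rfl hκγ hsm x hx

theorem nu_union (h : RieszTau 𝒦 𝒢 ℬ ℱ 𝒯 ℓ τ) (hξ : IsXi 𝒦 𝒢 τ ξ) (hν : IsNu 𝒢 ξ ν)
    {ρ₁ ρ₂ : Set S} (h₁ : ρ₁ ∈ RSet 𝒦 𝒢 ℬ τ) (h₂ : ρ₂ ∈ RSet 𝒦 𝒢 ℬ τ) (hd : Disjoint ρ₁ ρ₂)
    (x : X) : ν (ρ₁ ∪ ρ₂) x = ν ρ₁ x + ν ρ₂ x := by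
  obtain ⟨B, hB, hx⟩ := h.sys.B_cover x
  refine eq_of_uniformity fun {W} hW => ?_
  obtain ⟨V₀, hV₀, -, hc⟩ := exists_isUnifEnt_comp h.add hW
  obtain ⟨V₁, hV₁, hclose⟩ := h.exists_nu_close hξ hν hB hV₀.1
  obtain ⟨V, hV, hVV₁, hun⟩ := h.exists_wSmall_union hB hV₁.1
  obtain ⟨κ₁, hκ₁, γ₁, hγ₁, hκρ₁, hργ₁, hsm₁⟩ := h₁ B hB V hV
  obtain ⟨κ₂, hκ₂, γ₂, hγ₂, hκρ₂, hργ₂, hsm₂⟩ := h₂ B hB V hV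
  have e₁ := hclose κ₁ hκ₁ γ₁ hγ₁ ρ₁ hκρ₁ hργ₁ (hsm₁.mono hVV₁ subset_rfl) x hx
  have e₂ := hclose κ₂ hκ₂ γ₂ hγ₂ ρ₂ hκρ₂ hργ₂ (hsm₂.mono hVV₁ subset_rfl) x hx
  have e₃ := hclose _ (h.sys.K_union _ hκ₁ _ hκ₂) _ (h.sys.G_union _ hγ₁ _ hγ₂) (ρ₁ ∪ ρ₂)
    (Set.union_subset_union hκρ₁ hκρ₂) (Set.union_subset_union hργ₁ hργ₂)
    ((hun _ _ hsm₁ hsm₂).mono subset_rfl (by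
      rintro s ⟨hs | hs, hs'⟩
      · exact Or.inl ⟨hs, fun hsκ => hs' (Or.inl hsκ)⟩
      · exact Or.inr ⟨hs, fun hsκ => hs' (Or.inr hsκ)⟩)) x hx
  rw [h.tau_union hκ₁ hκ₂ (hd.mono hκρ₁ hκρ₂)] at e₃
  exact hc _ _ _ _ _ (hV₀.symm e₃) (hV₀.add_right e₁ _) (hV₀.add_left e₂ _) (hV₀.rfl _)

theorem exists_nu_uniform (h : RieszTau 𝒦 𝒢 ℬ ℱ 𝒯 ℓ τ) (hξ : IsXi 𝒦 𝒢 τ ξ)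
    (hν : IsNu 𝒢 ξ ν) {B : Set X} (hB : B ∈ ℬ) (α : Set S) {W : Set (Z × Z)}
    (hW : W ∈ uniformity Z) :
    ∃ γ ∈ 𝒢, α ⊆ γ ∧ ∀ γ' ∈ 𝒢, α ⊆ γ' → γ' ⊆ γ → ∀ x ∈ B, (ξ γ' x, ν α x) ∈ W := by
  obtain ⟨V, hV, -, hc⟩ := exists_isUnifEnt_comp h.add hW
  obtain ⟨γ, hγ, hαγ, hcau⟩ := h.exists_xi_cauchy hξ hB α hV.1
  refine ⟨γ, hγ, hαγ, fun γ' hγ' hαγ' hγγ x hx => ?_⟩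
  obtain ⟨γ₀, hγ₀, hαγ₀, hap⟩ := h.exists_nu_approx hν α x hV
  have hi := h.sys.G_inter _ hγ _ hγ₀
  have hαi := Set.subset_inter hαγ hαγ₀
  exact hc _ _ _ _ _ (hcau γ' hγ' hαγ' hγγ x hx)
    (hV.symm (hcau _ hi hαi Set.inter_subset_left x hx)) (hap _ hi hαi Set.inter_subset_right)
    (hV.rfl _)


end RieszTau

theorem stmt19 {S : Type u} {X : Type v} {Z : Type w}
    [AddCommMonoid X] [UniformSpace X] [T2Space X]
    [AddCommMonoid Z] [UniformSpace Z] [T2Space Z]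
    (hZadd : UniformContinuous fun p : Z × Z => p.1 + p.2)
    {𝒦 𝒢 : Set (Set S)} {ℬ : Set (Set X)} {ℱ : Set (S → X)}
    {𝒯 : Filter ((S → X) × (S → X))}
    (hRS : RieszSystem 𝒦 𝒢 ℬ ℱ 𝒯)
    (ℓ : (S → X) → Z) (hℓ : RieszIntegral 𝒦 𝒢 ℬ ℱ 𝒯 ℓ)
    (τ ξ : Set S → X → Z) (hτ : IsTau 𝒦 𝒢 ℬ ℱ ℓ τ) (hξ : IsXi 𝒦 𝒢 τ ξ) :
    (𝒦 ∪ 𝒢 ⊆ RSet 𝒦 𝒢 ℬ τ) ∧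
    IsSetField (RSet 𝒦 𝒢 ℬ τ) ∧
    ∃ ν : Set S → X → Z, IsNu 𝒢 ξ ν ∧
      (∀ κ ∈ 𝒦, ∀ x : X, ν κ x = τ κ x) ∧
      (∀ ρ₁ ∈ RSet 𝒦 𝒢 ℬ τ, ∀ ρ₂ ∈ RSet 𝒦 𝒢 ℬ τ, Disjoint ρ₁ ρ₂ →
        ∀ x : X, ν (ρ₁ ∪ ρ₂) x = ν ρ₁ x + ν ρ₂ x) ∧
      ∀ B ∈ ℬ, ∀ α : Set S, ∀ W : Set (Z × Z), IsUnifEnt Z W →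
        ∃ γ ∈ 𝒢, α ⊆ γ ∧ ∀ γ' ∈ 𝒢, α ⊆ γ' → γ' ⊆ γ → ∀ x ∈ B, (ξ γ' x, ν α x) ∈ W := by
  have h : RieszTau 𝒦 𝒢 ℬ ℱ 𝒯 ℓ τ := ⟨hZadd, hRS, hℓ, hτ⟩
  obtain ⟨ν, hν⟩ := h.exists_nu hξ
  exact ⟨Set.union_subset (fun _ => h.mem_RSet_of_mem_K) fun _ => h.mem_RSet_of_mem_G,
    h.isSetField_RSet, ν, hν, fun κ hκ => h.nu_eq_tau hξ hν hκ,
    fun ρ₁ h₁ ρ₂ h₂ => h.nu_union hξ hν h₁ h₂,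
    fun B hB α W hW => h.exists_nu_uniform hξ hν hB α hW.1⟩
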